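/- arXiv:2503.09442 — 2 statements merged into one kernel-verified Lean document; each statement's English description precedes it below -/
import Mathlib

section
/- Let r ≥ 1 be an integer and let p > max{4/r, 2} be a real number. Then there exists a constant C = C(r, p) > 0 such that for every b ∈ ℝ^r, every real N > 1, and every family of complex coefficients (a_ξ)_{ξ ∈ ℤ^r}, one has (∫_0^{2π} |∑_{ξ ∈ J_{b,N}} a_ξ e^{−i t |ξ|²}|^p dt)^{1/p} ≤ C · N^{r/2 − 2/p} · (∑_{ξ ∈ J_{b,N}} |a_ξ|²)^{1/2}. In particular, the constant C is independent of b and N. -/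
open MeasureTheory Real

noncomputable section

/-- The lattice box `J_{b,N} = {ξ ∈ ℤ^r : b i ≤ ξ i ≤ b i + N for all i}`. -/
def latticeBox (r : ℕ) (b : Fin r → ℝ) (N : ℝ) : Finset (Fin r → ℤ) :=
  Fintype.piFinset fun i => Finset.Icc ⌈b i⌉ ⌊b i + N⌋

/-- The squared Euclidean norm `|ξ|²` of a lattice point. -/
def eNormSq {r : ℕ} (ξ : Fin r → ℤ) : ℝ := ∑ i, ((ξ i : ℝ)) ^ 2

/-- The number of divisors of `n` lying in `[1, Q]`. -/
def divCount (Q n : ℕ) : ℕ := ((Finset.Icc 1 Q).filter (· ∣ n)).card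

lemma divCount_mul_le (Q m n : ℕ) : divCount Q (m * n) ≤ divCount Q m * divCount Q n := by
  unfold divCount
  rw [← Finset.card_product]
  refine Finset.card_le_card_of_injOn (fun q => (Nat.gcd q m, q / Nat.gcd q m)) ?_ ?_
  · intro q hq
    simp only [Finset.coe_filter, Finset.mem_Icc, Set.mem_ofPred_eq] at hq
    obtain ⟨⟨h1, hQ⟩, hd⟩ := hq
    have hg : 0 < Nat.gcd q m := Nat.gcd_pos_of_pos_left _ h1
    have hgq : Nat.gcd q m ≤ q := Nat.le_of_dvd h1 (Nat.gcd_dvd_left q m)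
    simp only [Finset.coe_product, Finset.coe_filter, Finset.mem_Icc, Set.mem_prod,
      Set.mem_ofPred_eq]
    refine ⟨⟨⟨hg, hgq.trans hQ⟩, Nat.gcd_dvd_right q m⟩,
      ⟨Nat.div_pos hgq hg, (Nat.div_le_self _ _).trans hQ⟩, ?_⟩
    have hc : Nat.Coprime (q / Nat.gcd q m) (m / Nat.gcd q m) := Nat.coprime_div_gcd_div_gcd hg
    refine hc.dvd_of_dvd_mul_left ?_
    refine Nat.dvd_of_mul_dvd_mul_left hg ?_
    rw [Nat.mul_div_cancel' (Nat.gcd_dvd_left q m), ← mul_assoc,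
      Nat.mul_div_cancel' (Nat.gcd_dvd_right q m)]
    exact hd
  · intro q _ q' _ h
    simp only [Prod.mk.injEq] at h
    rw [← Nat.mul_div_cancel' (Nat.gcd_dvd_left q m), ← Nat.mul_div_cancel' (Nat.gcd_dvd_left q' m),
      h.2, h.1]

lemma sum_filter_dvd_Icc (g : ℕ → ℝ) (Y e : ℕ) (he : 1 ≤ e) :
    ∑ n ∈ (Finset.Icc 1 Y).filter (e ∣ ·), g n = ∑ f ∈ Finset.Icc 1 (Y / e), g (e * f) := by
  symm
  refine Finset.sum_bij (fun f _ => e * f) ?_ ?_ ?_ ?_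
  · intro f hf
    simp only [Finset.mem_Icc, Finset.mem_filter] at hf ⊢
    refine ⟨⟨Nat.mul_pos he hf.1, ?_⟩, dvd_mul_right _ _⟩
    calc e * f ≤ e * (Y / e) := Nat.mul_le_mul_left _ hf.2
      _ ≤ Y := Nat.mul_div_le _ _
  · intro f _ f' _ h
    exact Nat.eq_of_mul_eq_mul_left he h
  · intro n hn
    simp only [Finset.mem_Icc, Finset.mem_filter] at hn
    obtain ⟨⟨h1, h2⟩, f, rfl⟩ := hn
    refine ⟨f, ?_, rfl⟩
    rw [Finset.mem_Icc]
    exact ⟨Nat.pos_of_mul_pos_left h1, (Nat.le_div_iff_mul_le he).2 (by rwa [mul_comm])⟩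
  · intros; rfl

lemma sum_mul_divCount (g : ℕ → ℝ) (Q Y : ℕ) :
    ∑ n ∈ Finset.Icc 1 Y, (divCount Q n : ℝ) * g n
      = ∑ e ∈ Finset.Icc 1 Q, ∑ f ∈ Finset.Icc 1 (Y / e), g (e * f) := by
  have h : ∀ n, (divCount Q n : ℝ) * g n = ∑ e ∈ Finset.Icc 1 Q, if e ∣ n then g n else 0 := by
    intro n
    rw [← Finset.sum_filter, Finset.sum_const, nsmul_eq_mul, divCount]
  simp_rw [h]
  rw [Finset.sum_comm]
  refine Finset.sum_congr rfl fun e he => ?_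
  rw [← Finset.sum_filter, sum_filter_dvd_Icc g Y e (Finset.mem_Icc.1 he).1]

lemma sum_divCount_pow_div_le (Q m : ℕ) :
    ∑ q ∈ Finset.Icc 1 Q, (divCount Q q : ℝ) ^ m / q
      ≤ (∑ q ∈ Finset.Icc 1 Q, (1 : ℝ) / q) ^ 2 ^ m := by
  induction m with
  | zero => simp
  | succ m ih =>
    have h1 : ∀ q : ℕ, (divCount Q q : ℝ) ^ (m + 1) / q
        = (divCount Q q : ℝ) * ((divCount Q q : ℝ) ^ m / q) := fun q => by ring
    simp_rw [h1]
    rw [sum_mul_divCount]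
    calc _ ≤ ∑ e ∈ Finset.Icc 1 Q, ∑ f ∈ Finset.Icc 1 Q,
          ((divCount Q e : ℝ) ^ m / e) * ((divCount Q f : ℝ) ^ m / f) := by
          refine Finset.sum_le_sum fun e _ => ?_
          refine (Finset.sum_le_sum fun f _ => ?_).trans
            (Finset.sum_le_sum_of_subset_of_nonneg
              (Finset.Icc_subset_Icc_right (Nat.div_le_self Q e)) fun f _ _ => by positivity)
          rw [div_mul_div_comm, ← mul_pow, Nat.cast_mul]
          gcongr
          exact_mod_cast divCount_mul_le Q e f
      _ = (∑ q ∈ Finset.Icc 1 Q, (divCount Q q : ℝ) ^ m / q) ^ 2 := by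
          rw [sq, Finset.sum_mul_sum]
      _ ≤ _ := by
          rw [pow_succ 2 m, pow_mul]
          gcongr

lemma sum_divCount_pow_le (Q m Y : ℕ) (hQ : 1 ≤ Q) :
    ∑ n ∈ Finset.Icc 1 Y, (divCount Q n : ℝ) ^ m
      ≤ Y * (∑ q ∈ Finset.Icc 1 Q, (1 : ℝ) / q) ^ 2 ^ m := by
  set h := ∑ q ∈ Finset.Icc 1 Q, (1 : ℝ) / q with hh
  have hone : 1 ≤ h := by
    have := Finset.single_le_sum (f := fun q : ℕ => (1 : ℝ) / q) (s := Finset.Icc 1 Q)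
      (fun i _ => by positivity) (Finset.mem_Icc.2 ⟨le_refl 1, hQ⟩)
    simpa [hh] using this
  induction m generalizing Y with
  | zero => simpa using le_mul_of_one_le_right (Nat.cast_nonneg Y) hone
  | succ m ih =>
    simp_rw [pow_succ' _ m]
    rw [sum_mul_divCount]
    calc _ ≤ ∑ e ∈ Finset.Icc 1 Q, (divCount Q e : ℝ) ^ m * (Y / e * h ^ 2 ^ m) := by
          refine Finset.sum_le_sum fun e _ => ?_
          calc _ ≤ ∑ f ∈ Finset.Icc 1 (Y / e), (divCount Q e : ℝ) ^ m * (divCount Q f : ℝ) ^ m := by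
                refine Finset.sum_le_sum fun f _ => ?_
                rw [← mul_pow]
                gcongr
                exact_mod_cast divCount_mul_le Q e f
            _ ≤ _ := by
                rw [← Finset.mul_sum]
                gcongr
                refine (ih (Y / e)).trans ?_
                gcongr
                exact Nat.cast_div_le
      _ = Y * h ^ 2 ^ m * ∑ q ∈ Finset.Icc 1 Q, (divCount Q q : ℝ) ^ m / q := by
          rw [Finset.mul_sum]
          exact Finset.sum_congr rfl fun e _ => by ring
      _ ≤ Y * h ^ 2 ^ m * h ^ 2 ^ m := by
          gcongr
          exact sum_divCount_pow_div_le Q m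
      _ = _ := by rw [mul_comm 2 (2 ^ m), pow_mul h]; ring

lemma sum_sum_mul_le (u : ℕ → ℝ) (B : ℝ) (hu : ∀ n, 0 ≤ u n) (huB : ∀ n, u n ≤ B)
    (Q X k : ℕ) (hQ : 1 ≤ Q) (D : ℝ) (hD : 0 < D) :
    ∑ q ∈ Finset.Icc 1 Q, ∑ l ∈ Finset.Icc 1 X, u (q * l)
      ≤ D * ∑ n ∈ Finset.Icc 1 (Q * X), u n
        + B * (Q * X) * (∑ q ∈ Finset.Icc 1 Q, (1 : ℝ) / q) ^ 2 ^ (k + 1) / D ^ k := by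
  have hB : 0 ≤ B := (hu 0).trans (huB 0)
  calc _ ≤ ∑ q ∈ Finset.Icc 1 Q, ∑ l ∈ Finset.Icc 1 (Q * X / q), u (q * l) := by
        refine Finset.sum_le_sum fun q hq => ?_
        rw [Finset.mem_Icc] at hq
        refine Finset.sum_le_sum_of_subset_of_nonneg (Finset.Icc_subset_Icc_right ?_)
          fun _ _ _ => hu _
        rw [Nat.le_div_iff_mul_le hq.1, mul_comm]
        exact Nat.mul_le_mul_right _ hq.2
    _ = ∑ n ∈ Finset.Icc 1 (Q * X), (divCount Q n : ℝ) * u n := (sum_mul_divCount _ _ _).symm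
    _ ≤ ∑ n ∈ Finset.Icc 1 (Q * X), (D * u n + B / D ^ k * (divCount Q n : ℝ) ^ (k + 1)) := by
        refine Finset.sum_le_sum fun n _ => ?_
        rcases le_total (divCount Q n : ℝ) D with h | h
        · have : 0 ≤ B / D ^ k * (divCount Q n : ℝ) ^ (k + 1) := by positivity
          nlinarith [mul_le_mul_of_nonneg_right h (hu n)]
        · have h1 : (divCount Q n : ℝ) * u n ≤ B / D ^ k * (divCount Q n : ℝ) ^ (k + 1) := by
            rw [div_mul_eq_mul_div, le_div_iff₀ (by positivity)]
            calc (divCount Q n : ℝ) * u n * D ^ k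
                ≤ (divCount Q n : ℝ) * B * (divCount Q n : ℝ) ^ k := by
                  gcongr
                  exact huB n
              _ = _ := by ring
          have := mul_nonneg hD.le (hu n)
          linarith
    _ ≤ _ := by
        rw [Finset.sum_add_distrib, ← Finset.mul_sum, ← Finset.mul_sum]
        have := sum_divCount_pow_le Q (k + 1) (Q * X) hQ
        have h2 : B / D ^ k * ∑ n ∈ Finset.Icc 1 (Q * X), (divCount Q n : ℝ) ^ (k + 1)
          ≤ B / D ^ k * ((Q * X : ℕ) * (∑ q ∈ Finset.Icc 1 Q, (1 : ℝ) / q) ^ 2 ^ (k + 1)) := by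
          gcongr
        refine add_le_add le_rfl (h2.trans_eq ?_)
        push_cast
        ring

lemma exists_natCast_add_one_le (ε : ℝ) (hε : 0 < ε) :
    ∃ C : ℝ, 1 ≤ C ∧ ∀ e : ℕ, (e : ℝ) + 1 ≤ C * (2 : ℝ) ^ (ε * e) := by
  have hc : 0 < ε * Real.log 2 := mul_pos hε (Real.log_pos one_lt_two)
  refine ⟨1 + 1 / (ε * Real.log 2), by simp only [le_add_iff_nonneg_right]; positivity,
    fun e => ?_⟩
  rw [Real.rpow_def_of_pos two_pos]
  have h1 := Real.add_one_le_exp (Real.log 2 * (ε * e))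
  have h2 : (1:ℝ) ≤ Real.exp (Real.log 2 * (ε * e)) := Real.one_le_exp (by
    have := (Real.log_pos one_lt_two).le
    positivity)
  have h3 : (e : ℝ) = 1 / (ε * Real.log 2) * (Real.log 2 * (ε * e)) := by
    field_simp
  have h4 : 1 / (ε * Real.log 2) * (Real.log 2 * (ε * e)) ≤
      1 / (ε * Real.log 2) * Real.exp (Real.log 2 * (ε * e)) := by
    gcongr
    linarith
  rw [add_mul, one_mul]
  linarith

lemma prod_count_add_one_le {α : Type*} [DecidableEq α] (w : α → ℝ) (s : Multiset α) (P : Finset α)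
    (ε : ℝ) (hε : 0 < ε) (C : ℝ) (hC : 1 ≤ C) (hCe : ∀ e : ℕ, (e : ℝ) + 1 ≤ C * (2 : ℝ) ^ (ε * e))
    (h2 : ∀ x ∈ s, 2 ≤ w x) (hP : ∀ x ∈ s, x ∉ P → (2 : ℝ) ^ (1 / ε) ≤ w x) :
    ∏ x ∈ s.toFinset, ((s.count x : ℝ) + 1) ≤ C ^ P.card * (s.map w).prod ^ ε := by
  have hw : ∀ x ∈ s.toFinset, 0 ≤ w x := fun x hx => by
    linarith [h2 x (Multiset.mem_toFinset.1 hx)]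
  rw [Finset.prod_multiset_map_count, ← Real.finsetProd_rpow _ _
    (fun x hx => pow_nonneg (hw x hx) _)]
  have hite : ∏ x ∈ s.toFinset, (if x ∈ P then C else 1) ≤ C ^ P.card := by
    rw [Finset.prod_ite, Finset.prod_const_one, mul_one, Finset.prod_const]
    refine pow_le_pow_right₀ hC (Finset.card_le_card fun x hx => (Finset.mem_filter.1 hx).2)
  refine le_trans ?_ (mul_le_mul_of_nonneg_right hite
    (Finset.prod_nonneg fun x hx => Real.rpow_nonneg (pow_nonneg (hw x hx) _) _))
  rw [← Finset.prod_mul_distrib]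
  refine Finset.prod_le_prod (fun x _ => by positivity) fun x hx => ?_
  have hxs := Multiset.mem_toFinset.1 hx
  have hx0 := hw x hx
  rw [← Real.rpow_natCast, ← Real.rpow_mul hx0, mul_comm _ ε]
  split_ifs with hxP
  · refine (hCe _).trans ?_
    have := h2 x hxs
    gcongr
  · rw [one_mul]
    calc ((s.count x : ℝ) + 1) ≤ 2 ^ (s.count x) := by
          exact_mod_cast Nat.succ_le_of_lt Nat.lt_two_pow_self
      _ = ((2 : ℝ) ^ (1 / ε)) ^ (ε * s.count x) := by
          rw [← Real.rpow_mul two_pos.le, ← Real.rpow_natCast]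
          congr 1
          field_simp
      _ ≤ _ := by
          have := hP x hxs hxP
          gcongr

lemma GaussianInt.sq_add_sq_eq_norm (z : GaussianInt) : z.re ^ 2 + z.im ^ 2 = Zsqrtd.norm z := by
  rw [Zsqrtd.norm_def]; ring

lemma GaussianInt.mem_box {z : GaussianInt} {n : ℤ} (h : Zsqrtd.norm z ≤ n) :
    z ∈ ((Finset.Icc (-n) n) ×ˢ (Finset.Icc (-n) n)).image
      (fun p : ℤ × ℤ => (⟨p.1, p.2⟩ : GaussianInt)) := by
  rw [← GaussianInt.sq_add_sq_eq_norm] at h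
  have h1 := Int.le_self_sq z.re
  have h2 := Int.le_self_sq z.im
  have h3 := Int.le_self_sq (-z.re)
  have h4 := Int.le_self_sq (-z.im)
  have h5 := sq_nonneg z.re
  have h6 := sq_nonneg z.im
  rw [neg_sq] at h3 h4
  refine Finset.mem_image.2 ⟨(z.re, z.im), ?_, rfl⟩
  simp only [Finset.mem_product, Finset.mem_Icc]
  refine ⟨⟨by linarith, by linarith⟩, by linarith, by linarith⟩

open UniqueFactorizationMonoid in
lemma GaussianInt.card_norm_eq_le (ε : ℝ) (hε : 0 < ε) : ∃ C : ℝ, 0 < C ∧ ∀ k : ℕ, 1 ≤ k →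
    ∀ S : Finset GaussianInt, (∀ z ∈ S, Zsqrtd.norm z = k) → (S.card : ℝ) ≤ C * (k : ℝ) ^ ε := by
  classical
  obtain ⟨C, hC, hCe⟩ := exists_natCast_add_one_le (ε / 2) (half_pos hε)
  set T : ℤ := ⌈(2 : ℝ) ^ (1 / (ε / 2))⌉ with hT
  set P : Finset GaussianInt := ((Finset.Icc (-T) T) ×ˢ (Finset.Icc (-T) T)).image
      (fun p : ℤ × ℤ => (⟨p.1, p.2⟩ : GaussianInt)) with hP
  set U : Finset GaussianInt := ((Finset.Icc (-1 : ℤ) 1) ×ˢ (Finset.Icc (-1 : ℤ) 1)).image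
      (fun p : ℤ × ℤ => (⟨p.1, p.2⟩ : GaussianInt)) with hU
  have hUc : U.card ≤ 9 := Finset.card_image_le.trans (by decide)
  refine ⟨9 * C ^ P.card, by positivity, fun k hk S hS => ?_⟩
  let _ : StrongNormalizationMonoid GaussianInt :=
    UniqueFactorizationMonoid.strongNormalizationMonoid
  have hk0 : (k : GaussianInt) ≠ 0 := by exact_mod_cast (by omega : k ≠ 0)
  set s := normalizedFactors (k : GaussianInt) with hs
  have hz0 : ∀ z ∈ S, z ≠ 0 := by
    rintro z hz rfl
    have := hS 0 hz
    rw [Zsqrtd.norm_zero] at this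
    omega
  have hmaps : ∀ z ∈ S, normalizedFactors z ∈ Finset.Iic s := by
    intro z hz
    rw [Finset.mem_Iic, hs, ← dvd_iff_normalizedFactors_le_normalizedFactors (hz0 z hz) hk0]
    have := Zsqrtd.norm_eq_mul_conj z
    rw [hS z hz] at this
    exact ⟨star z, by simpa using this⟩
  have hcard : S.card ≤ 9 * (Finset.Iic s).card := by
    refine Finset.card_le_mul_card_image_of_maps_to hmaps 9 fun m _ => ?_
    rcases Finset.eq_empty_or_nonempty ({z ∈ S | normalizedFactors z = m}) with h | ⟨z₀, hz₀⟩
    · rw [h]; simp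
    · refine (Finset.card_le_card (t := U.image (z₀ * ·)) ?_).trans
        (Finset.card_image_le.trans hUc)
      intro z hz
      rw [Finset.mem_filter] at hz hz₀
      have hass : Associated z₀ z :=
        (associated_iff_normalizedFactors_eq_normalizedFactors (hz0 _ hz₀.1) (hz0 _ hz.1)).2
          (hz₀.2.trans hz.2.symm)
      obtain ⟨u, rfl⟩ := hass
      refine Finset.mem_image.2 ⟨u, ?_, rfl⟩
      refine GaussianInt.mem_box (le_of_eq ?_)
      exact (Zsqrtd.norm_eq_one_iff' (by norm_num) _).2 u.isUnit
  set w : GaussianInt → ℝ := fun z => (Zsqrtd.norm z : ℝ) with hw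
  have hmem2 : ∀ x ∈ s, (2 : ℤ) ≤ Zsqrtd.norm x := by
    intro x hx
    have hir := irreducible_of_normalized_factor x hx
    have h0 : 0 ≤ Zsqrtd.norm x := GaussianInt.norm_nonneg x
    have h1 : Zsqrtd.norm x ≠ 0 := fun h =>
      hir.ne_zero ((Zsqrtd.norm_eq_zero_iff (by norm_num) x).1 h)
    have h2 : Zsqrtd.norm x ≠ 1 := fun h =>
      hir.not_isUnit ((Zsqrtd.norm_eq_one_iff' (by norm_num) x).1 h)
    omega
  have hprod : (s.map w).prod = (k : ℝ) ^ 2 := by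
    have h1 : Zsqrtd.norm s.prod = Zsqrtd.norm (k : GaussianInt) := by
      obtain ⟨u, hu⟩ := prod_normalizedFactors hk0
      rw [← hu, Zsqrtd.norm_mul, (Zsqrtd.norm_eq_one_iff' (by norm_num) _).2 u.isUnit, mul_one]
    have h2 : (s.map w).prod = ((Zsqrtd.norm s.prod : ℤ) : ℝ) := by
      have : w = ((Int.castRingHom ℝ : ℤ →* ℝ).comp Zsqrtd.normMonoidHom : GaussianInt →* ℝ) := by
        ext z; simp [hw, Zsqrtd.normMonoidHom]
      rw [this, Multiset.prod_hom]
      simp [Zsqrtd.normMonoidHom]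
    rw [h2, h1, Zsqrtd.norm_natCast]
    push_cast
    ring
  have hmain := prod_count_add_one_le w s P (ε / 2) (half_pos hε) C hC hCe
    (fun x hx => by
      have := hmem2 x hx
      simp only [hw]
      exact_mod_cast this) (fun x hx hxP => by
      by_contra hlt
      push Not at hlt
      refine hxP (GaussianInt.mem_box ?_)
      have : ((Zsqrtd.norm x : ℤ) : ℝ) ≤ (T : ℝ) := hlt.le.trans (Int.le_ceil _)
      exact_mod_cast this)
  rw [hprod, ← Real.rpow_natCast (k : ℝ) 2, ← Real.rpow_mul (Nat.cast_nonneg k)] at hmain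
  have he : ((2 : ℕ) : ℝ) * (ε / 2) = ε := by push_cast; ring
  rw [he] at hmain
  have hI : ((Finset.Iic s).card : ℝ) = ∏ x ∈ s.toFinset, ((s.count x : ℝ) + 1) := by
    rw [Multiset.card_Iic]; push_cast; rfl
  calc (S.card : ℝ) ≤ 9 * ((Finset.Iic s).card : ℝ) := by exact_mod_cast hcard
    _ ≤ 9 * (C ^ P.card * (k : ℝ) ^ ε) := by rw [hI]; gcongr
    _ = _ := by ring

/-- A circle of large radius meets a box of side `N` in at most two lattice points. -/
lemma card_le_two_of_large (N : ℝ) (hN : 1 < N) (k : ℤ) (hk : 8 * N ^ 6 < k) (S : Finset (ℤ × ℤ))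
    (hS : ∀ z ∈ S, z.1 ^ 2 + z.2 ^ 2 = k)
    (hd : ∀ z ∈ S, ∀ w ∈ S, |((z.1 - w.1 : ℤ) : ℝ)| ≤ N ∧ |((z.2 - w.2 : ℤ) : ℝ)| ≤ N) :
    S.card ≤ 2 := by
  by_contra hcon
  push Not at hcon
  obtain ⟨z, hz, w, hw, v, hv, hzw, hzv, hwv⟩ := Finset.two_lt_card.1 hcon
  obtain ⟨x, y⟩ := z
  obtain ⟨x₁, y₁⟩ := w
  obtain ⟨x₂, y₂⟩ := v
  have e0 := hS _ hz
  have e1 := hS _ hw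
  have e2 := hS _ hv
  have d1 := hd _ hw _ hz
  have d2 := hd _ hv _ hz
  simp only at e0 e1 e2 d1 d2
  obtain ⟨a, rfl⟩ : ∃ a, x₁ = x + a := ⟨x₁ - x, by ring⟩
  obtain ⟨b, rfl⟩ : ∃ b, y₁ = y + b := ⟨y₁ - y, by ring⟩
  obtain ⟨c, rfl⟩ : ∃ c, x₂ = x + c := ⟨x₂ - x, by ring⟩
  obtain ⟨d, rfl⟩ : ∃ d, y₂ = y + d := ⟨y₂ - y, by ring⟩
  simp only [add_sub_cancel_left] at d1 d2
  have f1 : 2 * (x * a + y * b) = -(a ^ 2 + b ^ 2) := by linarith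
  have f2 : 2 * (x * c + y * d) = -(c ^ 2 + d ^ 2) := by linarith
  have hx : 2 * x * (a * d - b * c) = -(a ^ 2 + b ^ 2) * d + (c ^ 2 + d ^ 2) * b := by
    linear_combination d * f1 - b * f2
  have hy : 2 * y * (a * d - b * c) = (a ^ 2 + b ^ 2) * c - (c ^ 2 + d ^ 2) * a := by
    linear_combination a * f2 - c * f1
  by_cases hD : a * d - b * c = 0
  · rw [hD, mul_zero] at hx hy
    have hab : a ^ 2 + b ^ 2 ≠ 0 := by
      intro h
      have ha : a = 0 := by nlinarith
      have hb : b = 0 := by nlinarith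
      simp [ha, hb] at hzw
    have hcd : c ^ 2 + d ^ 2 ≠ 0 := by
      intro h
      have ha : c = 0 := by nlinarith
      have hb : d = 0 := by nlinarith
      simp [ha, hb] at hzv
    have h3 : (a ^ 2 + b ^ 2) * (c ^ 2 + d ^ 2) * ((a - c) ^ 2 + (b - d) ^ 2) = 0 := by
      have g1 : (a ^ 2 + b ^ 2) * d = (c ^ 2 + d ^ 2) * b := by linarith
      have g2 : (a ^ 2 + b ^ 2) * c = (c ^ 2 + d ^ 2) * a := by linarith
      have g3 : (a ^ 2 + b ^ 2) * (c ^ 2 + d ^ 2) * (c ^ 2 + d ^ 2)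
          = (c ^ 2 + d ^ 2) * (c ^ 2 + d ^ 2) * (a * c + b * d) := by
        linear_combination (c ^ 2 + d ^ 2) * d * g1 + (c ^ 2 + d ^ 2) * c * g2
      have g4 : (a ^ 2 + b ^ 2) * (c ^ 2 + d ^ 2) = (c ^ 2 + d ^ 2) * (a * c + b * d) :=
        mul_left_cancel₀ hcd (by linear_combination g3)
      have g5 : a ^ 2 + b ^ 2 = a * c + b * d := mul_left_cancel₀ hcd (by linear_combination g4)
      have g6 : (c ^ 2 + d ^ 2) * (a ^ 2 + b ^ 2) = (a ^ 2 + b ^ 2) * (a * c + b * d) := by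
        linear_combination (-a) * g2 + (-b) * g1
      have g7 : c ^ 2 + d ^ 2 = a * c + b * d := mul_left_cancel₀ hab (by linear_combination g6)
      have : (a - c) ^ 2 + (b - d) ^ 2 = 0 := by linear_combination g5 + g7
      rw [this, mul_zero]
    have h4 : (a - c) ^ 2 + (b - d) ^ 2 = 0 := by
      rcases mul_eq_zero.1 h3 with h | h
      · exact absurd h (mul_ne_zero hab hcd)
      · exact h
    have ha : a = c := by nlinarith [sq_nonneg (a - c), sq_nonneg (b - d)]
    have hb : b = d := by nlinarith [sq_nonneg (a - c), sq_nonneg (b - d)]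
    exact hwv (by simp [ha, hb])
  · have hD1 : (1 : ℝ) ≤ |((a * d - b * c : ℤ) : ℝ)| := by
      exact_mod_cast Int.one_le_abs hD
    have sqle : ∀ u : ℤ, |(u : ℝ)| ≤ N → (u : ℝ) ^ 2 ≤ N ^ 2 := fun u hu => by
      rw [← sq_abs]; gcongr
    have sa := sqle a d1.1
    have sb := sqle b d1.2
    have sc := sqle c d2.1
    have sd := sqle d d2.2
    have hbound : ∀ X Y u v : ℝ, 0 ≤ X → 0 ≤ Y → X ≤ 2 * N ^ 2 → Y ≤ 2 * N ^ 2 → |u| ≤ N → |v| ≤ N →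
        |X * u - Y * v| ≤ 4 * N ^ 3 := by
      intro X Y u v hX hY hX' hY' hu hv
      calc |X * u - Y * v| ≤ |X * u| + |Y * v| := abs_sub _ _
        _ = X * |u| + Y * |v| := by rw [abs_mul, abs_mul, abs_of_nonneg hX, abs_of_nonneg hY]
        _ ≤ 2 * N ^ 2 * N + 2 * N ^ 2 * N := by gcongr
        _ = _ := by ring
    have key : ∀ w : ℤ, |((2 * w * (a * d - b * c) : ℤ) : ℝ)| ≤ 4 * N ^ 3 →
        (w : ℝ) ^ 2 ≤ 4 * N ^ 6 := by
      intro w h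
      rw [Int.cast_mul, abs_mul] at h
      have h1 : |((2 * w : ℤ) : ℝ)| ≤ 4 * N ^ 3 := by
        nlinarith [abs_nonneg ((2 * w : ℤ) : ℝ)]
      push_cast at h1
      rw [abs_mul, abs_two] at h1
      have h2 : |(w : ℝ)| ≤ 2 * N ^ 3 := by linarith
      rw [← sq_abs]
      calc |(w : ℝ)| ^ 2 ≤ (2 * N ^ 3) ^ 2 := by gcongr
        _ = _ := by ring
    have hX0 : (0 : ℝ) ≤ (a : ℝ) ^ 2 + (b : ℝ) ^ 2 := by positivity
    have hY0 : (0 : ℝ) ≤ (c : ℝ) ^ 2 + (d : ℝ) ^ 2 := by positivity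
    have hX1 : (a : ℝ) ^ 2 + (b : ℝ) ^ 2 ≤ 2 * N ^ 2 := by linarith
    have hY1 : (c : ℝ) ^ 2 + (d : ℝ) ^ 2 ≤ 2 * N ^ 2 := by linarith
    have bx := hbound _ _ _ _ hY0 hX0 hY1 hX1 d1.2 d2.2
    have bY := hbound _ _ _ _ hX0 hY0 hX1 hY1 d2.1 d1.1
    have kx := key x (by
      rw [hx]
      refine le_of_eq_of_le (congrArg abs ?_) bx
      push_cast
      ring)
    have ky := key y (by
      rw [hy]
      refine le_of_eq_of_le (congrArg abs ?_) bY
      push_cast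
      ring)
    have : (k : ℝ) = (x : ℝ) ^ 2 + (y : ℝ) ^ 2 := by rw [← e0]; push_cast; ring
    linarith

lemma card_circle_inter_box_le (ε : ℝ) (hε : 0 < ε) : ∃ C : ℝ, 0 < C ∧ ∀ N : ℝ, 1 < N → ∀ k : ℤ,
    ∀ S : Finset (ℤ × ℤ), (∀ z ∈ S, z.1 ^ 2 + z.2 ^ 2 = k) →
    (∀ z ∈ S, ∀ w ∈ S, |((z.1 - w.1 : ℤ) : ℝ)| ≤ N ∧ |((z.2 - w.2 : ℤ) : ℝ)| ≤ N) →
    (S.card : ℝ) ≤ C * N ^ ε := by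
  obtain ⟨C, hC, hCk⟩ := GaussianInt.card_norm_eq_le (ε / 6) (by positivity)
  refine ⟨C * 8 ^ (ε / 6) + 2, by positivity, fun N hN k S hS hd => ?_⟩
  have hN1 : 1 ≤ N ^ ε := Real.one_le_rpow hN.le hε.le
  have hmain : 2 * N ^ ε ≤ (C * 8 ^ (ε / 6) + 2) * N ^ ε := by
    have : 0 ≤ C * (8 : ℝ) ^ (ε / 6) * N ^ ε := by positivity
    linarith
  rcases lt_or_ge (8 * N ^ 6) (k : ℝ) with h | h
  · have := card_le_two_of_large N hN k h S hS hd
    have h2 : (S.card : ℝ) ≤ 2 := by exact_mod_cast this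
    linarith
  rcases le_or_gt k 0 with h0 | h0
  · have : S.card ≤ 1 := by
      refine Finset.card_le_one.2 ?_
      have hz : ∀ z ∈ S, z = (0, 0) := by
        rintro ⟨x, y⟩ hz
        have := hS _ hz
        simp only at this
        have hx : x = 0 := by nlinarith [sq_nonneg x, sq_nonneg y]
        have hy : y = 0 := by nlinarith [sq_nonneg x, sq_nonneg y]
        rw [hx, hy]
      intro z hz' w hw'
      rw [hz z hz', hz w hw']
    have h2 : (S.card : ℝ) ≤ 1 := by exact_mod_cast this
    linarith
  · obtain ⟨m, rfl⟩ := Int.eq_ofNat_of_zero_le h0.le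
    have hinj : Function.Injective (fun p : ℤ × ℤ => (⟨p.1, p.2⟩ : GaussianInt)) := by
      rintro ⟨x, y⟩ ⟨x', y'⟩ h
      simpa using h
    have := hCk m (by exact_mod_cast h0) (S.image (fun p : ℤ × ℤ => (⟨p.1, p.2⟩ : GaussianInt))) (by
      intro z hz
      obtain ⟨p, hp, rfl⟩ := Finset.mem_image.1 hz
      rw [← GaussianInt.sq_add_sq_eq_norm]
      exact hS p hp)
    rw [Finset.card_image_of_injective _ hinj] at this
    have h3 : (m : ℝ) ^ (ε / 6) ≤ (8 * N ^ 6) ^ (ε / 6) := by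
      gcongr
      exact_mod_cast h
    have h4 : (8 * N ^ 6 : ℝ) ^ (ε / 6) = 8 ^ (ε / 6) * N ^ ε := by
      rw [Real.mul_rpow (by norm_num) (by positivity), ← Real.rpow_natCast N 6,
        ← Real.rpow_mul (by linarith)]
      congr 2
      push_cast
      ring
    calc (S.card : ℝ) ≤ C * (8 ^ (ε / 6) * N ^ ε) := by
          rw [← h4]; exact this.trans (by gcongr)
      _ ≤ _ := by
        have : 0 ≤ N ^ ε := by positivity
        linarith

lemma norm_sum_exp_mul_dist_le (x : ℝ) (a b : ℤ) :
    ‖∑ m ∈ Finset.Icc a b, Complex.exp (Complex.I * ((2 * π * x * m : ℝ) : ℂ))‖ * |x - round x|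
      ≤ 1 / 2 := by
  set f : ℤ → ℂ := fun m => Complex.exp (Complex.I * ((2 * π * x * m : ℝ) : ℂ)) with hf
  have hnorm : ∀ m, ‖f m‖ = 1 := fun m => by
    simp only [hf]; rw [mul_comm]; exact Complex.norm_exp_ofReal_mul_I _
  set z : ℂ := Complex.exp (Complex.I * ((2 * π * (x - round x) : ℝ) : ℂ)) with hz
  have hstep : ∀ m, f (m + 1) = z * f m := by
    intro m
    simp only [hf, hz]
    rw [← Complex.exp_add, Complex.exp_eq_exp_iff_exists_int]
    refine ⟨round x, ?_⟩
    push_cast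
    ring
  have htel : ‖(z - 1) * ∑ m ∈ Finset.Icc a b, f m‖ ≤ 2 := by
    rcases lt_or_ge b a with h | h
    · rw [Finset.Icc_eq_empty (by omega)]; simp
    · have : (z - 1) * ∑ m ∈ Finset.Icc a b, f m = f (b + 1) - f a := by
        induction b, h using Int.leInduction with
        | base => rw [Finset.Icc_self, Finset.sum_singleton, hstep]; ring
        | succ b hb ih =>
          rw [← Finset.insert_Icc_right_eq_Icc_add_one (by omega : a ≤ b + 1),
            Finset.sum_insert (by simp), mul_add, ih, hstep (b + 1)]
          ring
      rw [this]
      refine (norm_sub_le _ _).trans ?_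
      rw [hnorm, hnorm]; norm_num
  have hzlow : 4 * |x - round x| ≤ ‖z - 1‖ := by
    rw [hz, Complex.norm_exp_I_mul_ofReal_sub_one, norm_mul, Real.norm_eq_abs, Real.norm_eq_abs,
      abs_two]
    have h1 := abs_sub_round x
    have h2 := Real.mul_abs_le_abs_sin (x := 2 * π * (x - round x) / 2) (by
      rw [mul_assoc, mul_div_cancel_left₀ _ two_ne_zero, abs_mul, abs_of_pos pi_pos]
      nlinarith [pi_pos])
    rw [mul_assoc, mul_div_cancel_left₀ _ two_ne_zero, abs_mul, abs_of_pos pi_pos, ← mul_assoc,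
      div_mul_cancel₀ _ pi_ne_zero, ← mul_div_cancel_left₀ (π * (x - round x)) two_ne_zero] at h2
    rw [mul_assoc]
    linarith
  rw [norm_mul] at htel
  nlinarith [norm_nonneg (∑ m ∈ Finset.Icc a b, f m), abs_nonneg (x - round x)]

/-- The one-dimensional quadratic exponential sum over `[b, b + N]`. -/
def quadSum (b N t : ℝ) : ℂ :=
  ∑ n ∈ Finset.Icc ⌈b⌉ ⌊b + N⌋, Complex.exp (-(Complex.I * (t : ℂ) * (((n : ℝ) ^ 2 : ℝ) : ℂ)))

lemma card_Icc_ceil_floor_le (b N : ℝ) (hN : 1 < N) :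
    ((Finset.Icc ⌈b⌉ ⌊b + N⌋).card : ℝ) ≤ 2 * N := by
  rw [Int.card_Icc]
  rcases le_total (⌊b + N⌋ + 1 - ⌈b⌉) 0 with h | h
  · rw [Int.toNat_of_nonpos h]; simp; linarith
  · have : (((⌊b + N⌋ + 1 - ⌈b⌉).toNat : ℤ) : ℝ) = ((⌊b + N⌋ + 1 - ⌈b⌉ : ℤ) : ℝ) := by
      rw [Int.toNat_of_nonneg h]
    rw [Int.cast_natCast] at this
    rw [this]
    push_cast
    linarith [Int.floor_le (b + N), Int.le_ceil b]

lemma norm_quadSum_le (b N t : ℝ) (hN : 1 < N) : ‖quadSum b N t‖ ≤ 2 * N := by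
  refine le_trans ?_ (card_Icc_ceil_floor_le b N hN)
  refine (norm_sum_le_of_le _ (n := fun _ => (1 : ℝ)) fun n _ => ?_).trans (by simp)
  have : -(Complex.I * (t : ℂ) * (((n : ℝ) ^ 2 : ℝ) : ℂ))
      = ((-(t * (n : ℝ) ^ 2) : ℝ) : ℂ) * Complex.I := by
    push_cast
    ring
  rw [this, Complex.norm_exp_ofReal_mul_I]

lemma norm_quadSum_sq_le (b N t : ℝ) (hN : 1 < N) : ∃ v : ℤ → ℝ,
    ‖quadSum b N t‖ ^ 2 ≤ ∑ h ∈ Finset.Icc (-⌊N⌋) ⌊N⌋, v h ∧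
    ∀ h, 0 ≤ v h ∧ v h ≤ 2 * N ∧ v h * |t / π * h - round (t / π * h)| ≤ 1 / 2 := by
  set J := Finset.Icc ⌈b⌉ ⌊b + N⌋ with hJ
  set e : ℤ → ℂ := fun n => Complex.exp (-(Complex.I * (t : ℂ) * (((n : ℝ) ^ 2 : ℝ) : ℂ))) with he
  set Jh : ℤ → Finset ℤ := fun h =>
    Finset.Icc (max ⌈b⌉ (⌈b⌉ + h)) (min ⌊b + N⌋ (⌊b + N⌋ + h)) with hJh
  have hterm : ∀ m h : ℤ, e (m - h) * (starRingEnd ℂ) (e m)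
      = Complex.exp (Complex.I * ((-(t * h ^ 2) : ℝ) : ℂ)) *
        Complex.exp (Complex.I * ((2 * π * (t / π * h) * m : ℝ) : ℂ)) := by
    intro m h
    simp only [he]
    rw [← Complex.exp_conj, ← Complex.exp_add, ← Complex.exp_add]
    congr 1
    have hπ : 2 * π * (t / π * h) * m = 2 * t * h * m := by field_simp
    rw [hπ]
    simp only [map_neg, map_mul, Complex.conj_I, Complex.conj_ofReal]
    push_cast
    ring
  refine ⟨fun h => ‖∑ m ∈ Jh h,
    Complex.exp (Complex.I * ((2 * π * (t / π * h) * m : ℝ) : ℂ))‖, ?_, fun h => ⟨norm_nonneg _, ?_,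
      norm_sum_exp_mul_dist_le _ _ _⟩⟩
  · have h1 : ((‖quadSum b N t‖ ^ 2 : ℝ) : ℂ) = ∑ p ∈ J ×ˢ J, e p.1 * (starRingEnd ℂ) (e p.2) := by
      rw [Complex.ofReal_pow, ← Complex.mul_conj', quadSum, map_sum, Finset.sum_mul_sum,
        Finset.sum_product]
    have h2 : ∑ p ∈ J ×ˢ J, e p.1 * (starRingEnd ℂ) (e p.2)
        = ∑ h ∈ Finset.Icc (-⌊N⌋) ⌊N⌋, ∑ m ∈ Jh h, e (m - h) * (starRingEnd ℂ) (e m) := by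
      rw [← Finset.sum_fiberwise_of_maps_to (t := Finset.Icc (-⌊N⌋) ⌊N⌋) (g := fun p => p.2 - p.1)]
      · refine Finset.sum_congr rfl fun h _ => ?_
        refine Finset.sum_bij' (fun p _ => p.2) (fun m _ => (m - h, m)) ?_ ?_ ?_ ?_ ?_
        · rintro ⟨n, m⟩ hp
          simp only [hJ, hJh, Finset.mem_filter, Finset.mem_product, Finset.mem_Icc] at hp ⊢
          omega
        · intro m hm
          simp only [hJ, hJh, Finset.mem_filter, Finset.mem_product, Finset.mem_Icc] at hm ⊢
          omega
        · rintro ⟨n, m⟩ hp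
          simp only [Finset.mem_filter] at hp
          simp only [Prod.mk.injEq, and_true]
          omega
        · intro m _; rfl
        · rintro ⟨n, m⟩ hp
          simp only [Finset.mem_filter] at hp
          have : n = m - h := by omega
          simp only [this]
      · rintro ⟨n, m⟩ hp
        simp only [hJ, Finset.mem_product, Finset.mem_Icc] at hp
        have h3 : ⌊b + N⌋ - ⌈b⌉ ≤ ⌊N⌋ := by
          rw [Int.le_floor]
          push_cast
          linarith [Int.floor_le (b + N), Int.le_ceil b]
        simp only [Finset.mem_Icc]
        omega
    have h3 : ‖quadSum b N t‖ ^ 2 = ‖((‖quadSum b N t‖ ^ 2 : ℝ) : ℂ)‖ := by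
      rw [Complex.norm_real, Real.norm_of_nonneg (by positivity)]
    rw [h3, h1, h2]
    refine norm_sum_le_of_le _ fun h _ => ?_
    simp_rw [hterm]
    rw [← Finset.mul_sum, norm_mul, mul_comm Complex.I, Complex.norm_exp_ofReal_mul_I, one_mul]
  · refine (norm_sum_le_of_le _ (n := fun _ => (1 : ℝ)) fun m _ => ?_).trans ?_
    · rw [mul_comm Complex.I, Complex.norm_exp_ofReal_mul_I]
    · rw [Finset.sum_const, nsmul_eq_mul, mul_one]
      refine le_trans ?_ (card_Icc_ceil_floor_le b N hN)
      exact_mod_cast Finset.card_le_card (Finset.Icc_subset_Icc (le_max_left _ _) (min_le_left _ _))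

lemma card_le_of_dvd_sub (S : Finset ℤ) (q : ℕ) (hq : 0 < q) (ℓ : ℝ) (hℓ : 0 ≤ ℓ)
    (hS : ∀ x ∈ S, ∀ y ∈ S, (q : ℤ) ∣ x - y ∧ ((x - y : ℤ) : ℝ) ≤ ℓ) :
    (S.card : ℝ) ≤ ℓ / q + 1 := by
  have hq' : (0 : ℝ) < q := by exact_mod_cast hq
  rcases S.eq_empty_or_nonempty with rfl | hne
  · simp; positivity
  set m := S.min' hne
  have hm : m ∈ S := S.min'_mem hne
  have hcard : S.card ≤ (Finset.Icc (0 : ℤ) ⌊ℓ / q⌋).card := by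
    refine Finset.card_le_card_of_injOn (fun x => (x - m) / q) ?_ ?_
    · intro x hx
      obtain ⟨⟨c, hc⟩, hle⟩ := hS x hx m hm
      have hmx : m ≤ x := S.min'_le x hx
      rw [Finset.coe_Icc, Set.mem_Icc]
      simp only
      rw [hc, Int.mul_ediv_cancel_left _ (by omega)]
      refine ⟨?_, ?_⟩
      · by_contra hneg
        push Not at hneg
        have : (q : ℤ) * c < 0 := mul_neg_of_pos_of_neg (by exact_mod_cast hq) hneg
        omega
      · rw [Int.le_floor, le_div_iff₀ hq']
        rw [hc] at hle
        push_cast at hle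
        linarith
    · intro x hx y hy h
      simp only at h
      obtain ⟨⟨c, hc⟩, -⟩ := hS x hx m hm
      obtain ⟨⟨d, hd⟩, -⟩ := hS y hy m hm
      rw [hc, hd, Int.mul_ediv_cancel_left _ (by omega), Int.mul_ediv_cancel_left _ (by omega)] at h
      rw [h] at hc
      omega
  have h0 : 0 ≤ ⌊ℓ / q⌋ := Int.floor_nonneg.2 (by positivity)
  rw [Int.card_Icc] at hcard
  have h2 : (S.card : ℤ) ≤ ⌊ℓ / q⌋ + 1 := by omega
  have h3 : (S.card : ℝ) ≤ (⌊ℓ / q⌋ : ℝ) + 1 := by exact_mod_cast h2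
  linarith [Int.floor_le (ℓ / q)]

lemma card_filter_dist_le (θ β N y : ℝ) (q : ℕ) (a : ℤ) (hN : 1 < N) (hq : 0 < q)
    (hqN : (q : ℝ) ≤ N)
    (hcop : IsCoprime (q : ℤ) a) (hβ : (q : ℝ) * θ = a + β) (hβN : |β| * N ≤ 1) (hy : 0 ≤ y) :
    (((Finset.Icc (-⌊N⌋) ⌊N⌋).filter fun h : ℤ => |θ * h - round (θ * h)| ≤ y).card : ℝ)
        ≤ 6 * N * y + 9 * N / q ∧
    (0 < |β| → (((Finset.Icc (-⌊N⌋) ⌊N⌋).filter fun h : ℤ => |θ * h - round (θ * h)| ≤ y).card : ℝ)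
        ≤ 6 * N * y + 3 * (2 * y / |β| + 1)) := by
  set S := (Finset.Icc (-⌊N⌋) ⌊N⌋).filter fun h : ℤ => |θ * h - round (θ * h)| ≤ y with hS
  have hq' : (0 : ℝ) < q := by exact_mod_cast hq
  set j : ℤ → ℤ := fun h => h * a - round (θ * h) * q with hj
  have hjβ : ∀ h ∈ S, |(j h : ℝ) + h * β| ≤ q * y := by
    intro h hh
    rw [hS, Finset.mem_filter] at hh
    have : (j h : ℝ) + h * β = q * (θ * h - round (θ * h)) := by
      simp only [hj]
      push_cast
      linear_combination (-(h : ℝ)) * hβ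
    rw [this, abs_mul, abs_of_pos hq']
    exact mul_le_mul_of_nonneg_left hh.2 hq'.le
  have habs : ∀ h ∈ S, |(h : ℝ)| ≤ N := by
    intro h hh
    rw [hS, Finset.mem_filter, Finset.mem_Icc] at hh
    have h1 : ((-⌊N⌋ : ℤ) : ℝ) ≤ h := by exact_mod_cast hh.1.1
    have h2 : (h : ℝ) ≤ (⌊N⌋ : ℝ) := by exact_mod_cast hh.1.2
    push_cast at h1
    rw [abs_le]
    constructor <;> linarith [Int.floor_le N]
  have hmaps : ∀ h ∈ S, j h ∈ Finset.Icc (-⌊q * y + 1⌋) ⌊q * y + 1⌋ := by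
    intro h hh
    have h1 : |(j h : ℝ)| ≤ q * y + 1 := by
      have h2 : |(h : ℝ) * β| ≤ 1 := by
        rw [abs_mul]
        nlinarith [habs h hh, abs_nonneg β]
      have h3 : (j h : ℝ) = ((j h : ℝ) + h * β) - h * β := by ring
      rw [h3]
      exact (abs_sub _ _).trans (add_le_add (hjβ h hh) h2)
    rw [abs_le] at h1
    rw [Finset.mem_Icc]
    refine ⟨?_, Int.le_floor.2 h1.2⟩
    rw [neg_le]
    exact Int.le_floor.2 (by push_cast; linarith)
  have hcardj : ((Finset.Icc (-⌊q * y + 1⌋) ⌊q * y + 1⌋).card : ℝ) ≤ 2 * q * y + 3 := by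
    have h0 : 0 ≤ ⌊q * y + 1⌋ := Int.floor_nonneg.2 (by positivity)
    rw [Int.card_Icc]
    have : (((⌊q * y + 1⌋ + 1 - -⌊q * y + 1⌋).toNat : ℤ) : ℝ)
        = ((⌊q * y + 1⌋ + 1 - -⌊q * y + 1⌋ : ℤ) : ℝ) := by
      rw [Int.toNat_of_nonneg (by omega)]
    rw [Int.cast_natCast] at this
    rw [this]
    push_cast
    linarith [Int.floor_le (q * y + 1)]
  have hcount : ∀ M : ℝ, 0 ≤ M → (∀ c, ((S.filter fun h => j h = c).card : ℝ) ≤ M) →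
      (S.card : ℝ) ≤ (2 * q * y + 3) * M := by
    intro M hM hc
    have := Finset.card_eq_sum_card_fiberwise hmaps
    rw [this]
    push_cast
    refine (Finset.sum_le_card_nsmul _ _ M fun c _ => hc c).trans ?_
    rw [nsmul_eq_mul]
    gcongr
  have hdvd : ∀ x ∈ S, ∀ y ∈ S, j x = j y → (q : ℤ) ∣ x - y := by
    intro x _ y _ h
    refine hcop.dvd_of_dvd_mul_right ?_
    refine ⟨round (θ * x) - round (θ * y), ?_⟩
    simp only [hj] at h
    linear_combination h
  have hfib : ∀ ℓ : ℝ, 0 ≤ ℓ → (∀ x ∈ S, ∀ y ∈ S, j x = j y → (x : ℝ) - y ≤ ℓ) →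
      (S.card : ℝ) ≤ (2 * q * y + 3) * (ℓ / q + 1) := by
    intro ℓ hℓ hd
    refine hcount _ (by positivity) fun c => card_le_of_dvd_sub _ q hq ℓ hℓ ?_
    intro x hx y hy
    rw [Finset.mem_filter] at hx hy
    refine ⟨hdvd x hx.1 y hy.1 (hx.2.trans hy.2.symm), ?_⟩
    push_cast
    exact hd x hx.1 y hy.1 (hx.2.trans hy.2.symm)
  have hA : (S.card : ℝ) ≤ (2 * q * y + 3) * (3 * N / q) := by
    refine (hfib (2 * N) (by linarith) fun x hx y hy _ => ?_).trans ?_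
    · linarith [abs_le.1 (habs x hx), abs_le.1 (habs y hy)]
    · gcongr
      rw [div_add_one hq'.ne']
      gcongr
      linarith
  have hA' : (2 * q * y + 3) * (3 * N / q) = 6 * N * y + 9 * N / q := by
    field_simp
    ring
  refine ⟨hA' ▸ hA, fun hβ0 => ?_⟩
  have hB : (S.card : ℝ) ≤ (2 * q * y + 3) * (2 * q * y / |β| / q + 1) := by
    refine hfib (2 * q * y / |β|) (by positivity) fun x hx y' hy' hxy => ?_
    rw [le_div_iff₀ hβ0]
    have h1 := hjβ x hx
    have h2 := hjβ y' hy'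
    rw [hxy] at h1
    have h3 : ((x : ℝ) - y') * β = ((j y' : ℝ) + x * β) - ((j y' : ℝ) + y' * β) := by ring
    calc ((x : ℝ) - y') * |β| ≤ |((x : ℝ) - y')| * |β| := by gcongr; exact le_abs_self _
      _ = |((j y' : ℝ) + x * β) - ((j y' : ℝ) + y' * β)| := by rw [← abs_mul, h3]
      _ ≤ q * y + q * y := (abs_sub _ _).trans (add_le_add h1 h2)
      _ = _ := by ring
  have hB' : 2 * q * y / |β| / q + 1 = 2 * y / |β| + 1 := by
    field_simp
  rw [hB'] at hB
  rcases le_total (3 * N / q) (2 * y / |β| + 1) with h | h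
  · rw [hA'] at hA
    have : 9 * N / q = 3 * (3 * N / q) := by ring
    linarith
  · have h5 : 2 * q * y * (2 * y / |β| + 1) ≤ 2 * q * y * (3 * N / q) := by gcongr
    have h6 : 2 * q * y * (3 * N / q) = 6 * N * y := by field_simp; ring
    linarith

lemma le_dyadic_sum (x B : ℝ) (hx : x ≤ B) (hB : 0 ≤ B) (n : ℕ) :
    x ≤ B / 2 ^ n + ∑ i ∈ Finset.range n, B / 2 ^ i * (if B / 2 ^ (i + 1) ≤ x then 1 else 0) := by
  induction n with
  | zero => simpa using hx
  | succ n ih =>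
    rw [Finset.sum_range_succ]
    have hnn : ∀ m, 0 ≤ ∑ i ∈ Finset.range m, B / 2 ^ i *
        (if B / 2 ^ (i + 1) ≤ x then (1 : ℝ) else 0) := fun m =>
      Finset.sum_nonneg fun i _ => by split_ifs <;> positivity
    split_ifs with h
    · have : 0 ≤ B / 2 ^ (n + 1) := by positivity
      linarith
    · have := hnn n
      push Not at h
      linarith

lemma exists_rational_approx_of_le_norm_quadSum (b N t η : ℝ) (I : ℕ) (hN : 1 < N) (hη : 0 < η)
    (hI : 12 ≤ η * 2 ^ I) (hIN : 24 * I ≤ η * N) (hK : η * N ^ 2 ≤ ‖quadSum b N t‖ ^ 2) :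
    ∃ q : ℕ, 0 < q ∧ q ≤ 144 / η ∧ ∃ a : ℤ, |q * (t / π) - a| ≤ 24 * (I + 2) / (η * N ^ 2) := by
  obtain ⟨v, hv, hvh⟩ := norm_quadSum_sq_le b N t hN
  set θ := t / π with hθ
  have hfl : 0 < ⌊N⌋₊ := Nat.floor_pos.2 hN.le
  obtain ⟨ρ, hρ, hden⟩ := Real.exists_rat_abs_sub_le_and_den_le θ hfl
  set q := ρ.den with hq
  have hq0 : 0 < q := ρ.den_pos
  have hq' : (0 : ℝ) < q := by exact_mod_cast hq0
  set β := (q : ℝ) * θ - ρ.num with hβ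
  have hqN : (q : ℝ) ≤ N := le_trans (by exact_mod_cast hden) (Nat.floor_le (by linarith))
  have hβN : |β| * N ≤ 1 := by
    have h1 : β = q * (θ - ρ) := by
      rw [hβ, mul_sub, Rat.cast_def ρ, ← hq, mul_div_cancel₀ _ hq'.ne']
    have hfl2 := Nat.lt_floor_add_one N
    rw [h1, abs_mul, abs_of_pos hq']
    calc q * |θ - ρ| * N ≤ q * (1 / ((⌊N⌋₊ + 1) * q)) * (⌊N⌋₊ + 1) := by gcongr
      _ = 1 := by field_simp
  have hcop : IsCoprime (q : ℤ) ρ.num := by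
    rw [Int.isCoprime_iff_nat_coprime]
    simpa using ρ.reduced.symm
  have hcount := fun y hy => card_filter_dist_le θ β N y q ρ.num hN hq0 hqN hcop
    (by rw [hβ]; ring) hβN hy
  set A := Finset.Icc (-⌊N⌋) ⌊N⌋ with hA
  set S : ℕ → Finset ℤ := fun i => A.filter fun h : ℤ =>
    |θ * h - round (θ * h)| ≤ 2 ^ i / (2 * N) with hS
  have hAcard : (A.card : ℝ) ≤ 3 * N := by
    have h0 : 0 ≤ ⌊N⌋ := Int.floor_nonneg.2 (by linarith)
    rw [hA, Int.card_Icc]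
    have : (((⌊N⌋ + 1 - -⌊N⌋).toNat : ℤ) : ℝ) = ((⌊N⌋ + 1 - -⌊N⌋ : ℤ) : ℝ) := by
      rw [Int.toNat_of_nonneg (by omega)]
    rw [Int.cast_natCast] at this
    rw [this]
    push_cast
    linarith [Int.floor_le N]
  have hsum : η * N ^ 2 ≤ η * N ^ 2 / 2
      + ∑ i ∈ Finset.range I, 2 * N / 2 ^ i * ((S i).card : ℝ) := by
    refine (hK.trans hv).trans ?_
    calc ∑ h ∈ A, v h ≤ ∑ h ∈ A, (2 * N / 2 ^ I + ∑ i ∈ Finset.range I, 2 * N / 2 ^ i *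
          (if |θ * h - round (θ * h)| ≤ 2 ^ i / (2 * N) then 1 else 0)) := by
          refine Finset.sum_le_sum fun h _ => ?_
          obtain ⟨h0, h1, h2⟩ := hvh h
          refine (le_dyadic_sum (v h) (2 * N) h1 (by linarith) I).trans ?_
          gcongr with i _
          split_ifs with h3 h4 h4
          · exact le_rfl
          · exfalso
            apply h4
            have h5 : 2 * N / 2 ^ (i + 1) = N / 2 ^ i := by rw [pow_succ]; field_simp
            rw [h5] at h3
            have h6 : N / 2 ^ i * |θ * h - round (θ * h)| ≤ 1 / 2 :=
              (mul_le_mul_of_nonneg_right h3 (abs_nonneg _)).trans h2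
            rw [le_div_iff₀ (by linarith)]
            rw [div_mul_eq_mul_div, div_le_iff₀ (by positivity)] at h6
            linarith
          · exact zero_le_one
          · exact le_rfl
      _ = A.card * (2 * N / 2 ^ I) + ∑ i ∈ Finset.range I, 2 * N / 2 ^ i * ((S i).card : ℝ) := by
          rw [Finset.sum_add_distrib, Finset.sum_const, nsmul_eq_mul, Finset.sum_comm]
          congr 1
          refine Finset.sum_congr rfl fun i _ => ?_
          rw [← Finset.mul_sum, Finset.sum_boole]
      _ ≤ _ := by
          gcongr
          have h1 : 2 * N / 2 ^ I ≤ η * N / 6 := by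
            rw [div_le_div_iff₀ (by positivity) (by norm_num)]
            nlinarith
          calc (A.card : ℝ) * (2 * N / 2 ^ I) ≤ 3 * N * (η * N / 6) := by gcongr
            _ = _ := by ring
  have hgeom : ∑ i ∈ Finset.range I, (1 : ℝ) / 2 ^ i ≤ 2 := by
    have := sum_geometric_two_le I
    simpa [one_div, inv_pow] using this
  have hbase : ∀ i : ℕ, 2 * N / 2 ^ i * (6 * N * (2 ^ i / (2 * N))) = 6 * N := fun i => by
    have : N ≠ 0 := by linarith
    field_simp
  have hI6 : (I : ℝ) * (6 * N) ≤ η * N ^ 2 / 4 := by nlinarith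
  refine ⟨q, hq0, ?_, ρ.num, ?_⟩
  · have h1 : ∑ i ∈ Finset.range I, 2 * N / 2 ^ i * ((S i).card : ℝ)
        ≤ I * (6 * N) + 18 * N ^ 2 / q * 2 := by
      calc _ ≤ ∑ i ∈ Finset.range I, (6 * N + 18 * N ^ 2 / q * (1 / 2 ^ i)) := by
            refine Finset.sum_le_sum fun i _ => ?_
            calc 2 * N / 2 ^ i * ((S i).card : ℝ)
                ≤ 2 * N / 2 ^ i * (6 * N * (2 ^ i / (2 * N)) + 9 * N / q) := by
                  gcongr
                  exact (hcount _ (by positivity)).1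
              _ = _ := by
                  rw [mul_add, hbase]
                  ring
        _ ≤ _ := by
            rw [Finset.sum_add_distrib, Finset.sum_const, Finset.card_range, nsmul_eq_mul,
              ← Finset.mul_sum]
            gcongr
    have h2 : η * N ^ 2 / 4 ≤ 18 * N ^ 2 / q * 2 := by linarith
    have h3 : 18 * N ^ 2 / q * 2 = 36 * N ^ 2 / q := by ring
    rw [h3, div_le_div_iff₀ (by norm_num) hq'] at h2
    rw [le_div_iff₀ hη]
    have : 0 < N ^ 2 := by positivity
    nlinarith
  · rcases (abs_nonneg β).eq_or_lt with h0 | h0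
    · rw [← h0]; positivity
    have h1 : ∑ i ∈ Finset.range I, 2 * N / 2 ^ i * ((S i).card : ℝ)
        ≤ I * (6 * N) + (I * (6 / |β|) + 6 * N * 2) := by
      calc _ ≤ ∑ i ∈ Finset.range I, (6 * N + (6 / |β| + 6 * N * (1 / 2 ^ i))) := by
            refine Finset.sum_le_sum fun i _ => ?_
            calc 2 * N / 2 ^ i * ((S i).card : ℝ)
                ≤ 2 * N / 2 ^ i * (6 * N * (2 ^ i / (2 * N))
                    + 3 * (2 * (2 ^ i / (2 * N)) / |β| + 1)) := by
                  gcongr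
                  exact (hcount _ (by positivity)).2 h0
              _ = _ := by
                  rw [mul_add, hbase]
                  have : N ≠ 0 := by linarith
                  field_simp
                  ring
        _ ≤ _ := by
            rw [Finset.sum_add_distrib, Finset.sum_add_distrib, Finset.sum_const, Finset.sum_const,
              Finset.card_range, nsmul_eq_mul, nsmul_eq_mul, ← Finset.mul_sum]
            gcongr
    have h2 : N ≤ 1 / |β| := by rwa [le_div_iff₀ h0, mul_comm]
    have h3 : η * N ^ 2 / 4 ≤ 6 * (I + 2) / |β| := by
      have : 6 * (I + 2) / |β| = I * (6 / |β|) + 12 * (1 / |β|) := by ring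
      linarith
    rw [le_div_iff₀ h0] at h3
    rw [le_div_iff₀ (by positivity)]
    linarith

/-- The character `t ↦ e^{int}`. -/
def expChar (n : ℤ) (t : ℝ) : ℂ := Complex.exp (((n * t : ℝ) : ℂ) * Complex.I)

lemma norm_expChar (n : ℤ) (t : ℝ) : ‖expChar n t‖ = 1 := Complex.norm_exp_ofReal_mul_I _

lemma continuous_expChar (n : ℤ) : Continuous (expChar n) := by
  unfold expChar
  fun_prop

lemma conj_expChar (n : ℤ) (t : ℝ) : (starRingEnd ℂ) (expChar n t) = expChar (-n) t := by
  unfold expChar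
  rw [← Complex.exp_conj, map_mul, Complex.conj_I, Complex.conj_ofReal]
  push_cast
  ring_nf

lemma expChar_add (n m : ℤ) (t : ℝ) : expChar (n + m) t = expChar n t * expChar m t := by
  unfold expChar
  rw [← Complex.exp_add]
  push_cast
  ring_nf

lemma expChar_sub_right (n : ℤ) (t s : ℝ) : expChar n (t - s) = expChar n t * expChar (-n) s := by
  unfold expChar
  rw [← Complex.exp_add]
  push_cast
  ring_nf

lemma integral_expChar (n : ℤ) :
    ∫ t in (0 : ℝ)..(2 * π), expChar n t = if n = 0 then 2 * (π : ℂ) else 0 := by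
  split_ifs with h
  · simp [h, expChar]
  · have hc : ((n : ℂ) * Complex.I) ≠ 0 := by simp [h]
    have : ∀ t : ℝ, expChar n t = Complex.exp ((n : ℂ) * Complex.I * t) := fun t => by
      unfold expChar
      push_cast
      ring_nf
    simp_rw [this]
    rw [integral_exp_mul_complex hc]
    have h1 : Complex.exp ((n : ℂ) * Complex.I * ((2 * π : ℝ) : ℂ)) = 1 := by
      rw [Complex.exp_eq_one_iff]
      exact ⟨n, by push_cast; ring⟩
    rw [h1]
    simp

lemma norm_sum_sq_eq {ι : Type*} (S : Finset ι) (z : ι → ℂ) :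
    ((‖∑ i ∈ S, z i‖ ^ 2 : ℝ) : ℂ) = ∑ i ∈ S, ∑ j ∈ S, z i * (starRingEnd ℂ) (z j) := by
  rw [Complex.ofReal_pow, ← Complex.mul_conj', map_sum, Finset.sum_mul_sum]

/-- Parseval's identity as an inequality, for frequencies of multiplicity at most `M`. -/
lemma integral_norm_sum_expChar_sq_le {ι : Type*} (S : Finset ι) (φ : ι → ℤ) (a : ι → ℂ) (M : ℝ)
    (hM : ∀ k, ((S.filter fun i => φ i = k).card : ℝ) ≤ M) :
    ∫ t in (0 : ℝ)..(2 * π), ‖∑ i ∈ S, a i * expChar (φ i) t‖ ^ 2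
      ≤ 2 * π * (M * ∑ i ∈ S, ‖a i‖ ^ 2) := by
  have h1 : ((∫ t in (0 : ℝ)..(2 * π), ‖∑ i ∈ S, a i * expChar (φ i) t‖ ^ 2 : ℝ) : ℂ)
      = ∑ i ∈ S, ∑ j ∈ S, a i * (starRingEnd ℂ) (a j) * if φ i = φ j then 2 * (π : ℂ) else 0 := by
    rw [← intervalIntegral.integral_ofReal]
    have h2 : ∀ t : ℝ, ((‖∑ i ∈ S, a i * expChar (φ i) t‖ ^ 2 : ℝ) : ℂ)
        = ∑ i ∈ S, ∑ j ∈ S, a i * (starRingEnd ℂ) (a j) * expChar (φ i - φ j) t := fun t => by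
      rw [norm_sum_sq_eq]
      refine Finset.sum_congr rfl fun i _ => Finset.sum_congr rfl fun j _ => ?_
      rw [map_mul, conj_expChar, sub_eq_add_neg, expChar_add]
      ring
    simp_rw [h2]
    have hInt : ∀ (c : ℂ) (n : ℤ), IntervalIntegrable (fun t => c * expChar n t) volume 0 (2 * π) :=
      fun c n => ((continuous_const.mul (continuous_expChar n))).intervalIntegrable _ _
    rw [intervalIntegral.integral_finsetSum]
    · refine Finset.sum_congr rfl fun i _ => ?_
      rw [intervalIntegral.integral_finsetSum fun j _ => hInt _ _]
      refine Finset.sum_congr rfl fun j _ => ?_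
      rw [intervalIntegral.integral_const_mul, integral_expChar]
      simp only [sub_eq_zero]
    · intro i _
      exact (continuous_finsetSum _ fun j _ =>
        continuous_const.mul (continuous_expChar _)).intervalIntegrable _ _
  have h0 : 0 ≤ ∫ t in (0 : ℝ)..(2 * π), ‖∑ i ∈ S, a i * expChar (φ i) t‖ ^ 2 :=
    intervalIntegral.integral_nonneg (by positivity) fun t _ => by positivity
  have h3 : ∀ i j, ‖a i * (starRingEnd ℂ) (a j) * if φ i = φ j then 2 * (π : ℂ) else 0‖
      ≤ π * (‖a i‖ ^ 2 * if φ i = φ j then 1 else 0)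
        + π * (‖a j‖ ^ 2 * if φ i = φ j then 1 else 0) := by
    intro i j
    split_ifs
    · simp only [norm_mul, RCLike.norm_conj, Complex.norm_real, Real.norm_of_nonneg pi_pos.le,
        Complex.norm_ofNat]
      nlinarith [mul_nonneg pi_pos.le (sq_nonneg (‖a i‖ - ‖a j‖))]
    · simp
  rw [← Real.norm_of_nonneg h0, ← Complex.norm_real, h1]
  have hcard : ∀ i ∈ S, ∑ j ∈ S, (if φ j = φ i then (1 : ℝ) else 0) ≤ M := fun i _ => by
    rw [Finset.sum_boole]
    exact hM _
  have hb : ∑ i ∈ S, ∑ j ∈ S, ‖a i‖ ^ 2 * (if φ j = φ i then (1 : ℝ) else 0)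
      ≤ M * ∑ i ∈ S, ‖a i‖ ^ 2 := by
    rw [Finset.mul_sum]
    refine Finset.sum_le_sum fun i hi => ?_
    rw [← Finset.mul_sum, mul_comm]
    exact mul_le_mul_of_nonneg_right (hcard i hi) (by positivity)
  calc _ ≤ ∑ i ∈ S, ∑ j ∈ S, (π * (‖a i‖ ^ 2 * if φ i = φ j then 1 else 0)
          + π * (‖a j‖ ^ 2 * if φ i = φ j then 1 else 0)) :=
        norm_sum_le_of_le _ fun i _ => norm_sum_le_of_le _ fun j _ => h3 i j
    _ = π * ∑ i ∈ S, ∑ j ∈ S, ‖a i‖ ^ 2 * (if φ j = φ i then (1 : ℝ) else 0)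
        + π * ∑ i ∈ S, ∑ j ∈ S, ‖a i‖ ^ 2 * (if φ j = φ i then (1 : ℝ) else 0) := by
        simp_rw [Finset.sum_add_distrib, ← Finset.mul_sum]
        congr 2
        · simp_rw [eq_comm]
        · simp_rw [Finset.mul_sum]
          rw [Finset.sum_comm]
    _ ≤ π * (M * ∑ i ∈ S, ‖a i‖ ^ 2) + π * (M * ∑ i ∈ S, ‖a i‖ ^ 2) := by gcongr
    _ = _ := by ring

lemma sum_norm_sq_integral_expChar_le (E : Set ℝ) (hE : E ⊆ Set.Ioc 0 (2 * π))
    (S : Finset ℤ) :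
    ∑ n ∈ S, ‖∫ t in E, expChar n t‖ ^ 2 ≤ 2 * π * volume.real E := by
  have hfin : volume E ≠ ⊤ := measure_ne_top_of_subset hE measure_Ioc_lt_top.ne
  set c : ℤ → ℂ := fun n => ∫ t in E, expChar n t with hc
  set s := ∑ n ∈ S, ‖c n‖ ^ 2 with hs
  set G : ℝ → ℂ := fun t => ∑ n ∈ S, (starRingEnd ℂ) (c n) * expChar n t with hG
  have hGc : Continuous G := continuous_finsetSum _ fun j _ =>
        continuous_const.mul (continuous_expChar _)
  have hInt : ∀ {F : Type} [NormedAddCommGroup F] (f : ℝ → F), Continuous f →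
      IntegrableOn f (Set.Ioc 0 (2 * π)) := fun f hf =>
    (hf.integrableOn_Icc).mono_set Set.Ioc_subset_Icc_self
  have h1 : (s : ℂ) = ∫ t in E, G t := by
    simp only [hG]
    rw [integral_finsetSum _ fun n _ =>
      ((hInt (fun t => (starRingEnd ℂ) (c n) * expChar n t)
        (continuous_const.mul (continuous_expChar n))).mono_set hE)]
    rw [hs]
    push_cast
    refine Finset.sum_congr rfl fun n _ => ?_
    rw [integral_const_mul]
    exact (Complex.conj_mul' _).symm
  have hs0 : 0 ≤ s := by positivity
  have h2 : s ≤ ∫ t in E, ‖G t‖ := by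
    calc s = ‖(s : ℂ)‖ := by rw [Complex.norm_real, Real.norm_of_nonneg hs0]
      _ ≤ _ := by rw [h1]; exact norm_integral_le_integral_norm _
  have hsq : IntegrableOn (fun t => (4 * π)⁻¹ * ‖G t‖ ^ 2) (Set.Ioc 0 (2 * π)) :=
    hInt _ (by fun_prop)
  have h3 : ∫ t in E, ‖G t‖ ≤ ∫ t in E, (π + (4 * π)⁻¹ * ‖G t‖ ^ 2) := by
    refine integral_mono ((hInt _ hGc.norm).mono_set hE) ?_ fun t => ?_
    · exact (integrable_const_iff.2 (Or.inr ⟨by simpa using hfin.lt_top⟩)).add (hsq.mono_set hE)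
    · have : 0 ≤ (4 * π)⁻¹ * (‖G t‖ - 2 * π) ^ 2 := by positivity
      have h4 : (4 * π)⁻¹ * (‖G t‖ - 2 * π) ^ 2 = π + (4 * π)⁻¹ * ‖G t‖ ^ 2 - ‖G t‖ := by
        field_simp
        ring
      simp only
      linarith
  have h4 : ∫ t in E, (π + (4 * π)⁻¹ * ‖G t‖ ^ 2) ≤ π * volume.real E + s / 2 := by
    rw [integral_add (integrable_const_iff.2 (Or.inr ⟨by simpa using hfin.lt_top⟩))
      (hsq.mono_set hE), setIntegral_const, smul_eq_mul, mul_comm]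
    gcongr
    refine (setIntegral_mono_set hsq (ae_of_all _ fun t => by positivity)
      (ae_of_all _ hE)).trans ?_
    rw [integral_const_mul, ← intervalIntegral.integral_of_le (by positivity)]
    have h5 := integral_norm_sum_expChar_sq_le S id (fun n => (starRingEnd ℂ) (c n)) 1 (fun k => by
      have : (S.filter fun i => id i = k) ⊆ {k} := fun x hx => by
        rw [Finset.mem_filter] at hx
        simpa using hx.2
      exact_mod_cast Finset.card_le_card this)
    simp only [id, RCLike.norm_conj, one_mul] at h5
    rw [inv_mul_le_iff₀ (by positivity)]
    refine h5.trans (le_of_eq ?_)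
    rw [hs]
    ring
  linarith

lemma half_le_norm_sum_expChar (q X : ℕ) (t : ℝ) (a : ℤ)
    (h : |q * (t / (2 * π)) - a| * X ≤ 1 / 6) :
    (X : ℝ) / 2 ≤ ‖∑ i ∈ Finset.range X, expChar (q * i : ℕ) t‖ := by
  refine le_trans ?_ (Complex.re_le_norm _)
  rw [Complex.re_sum]
  have : ∀ i ∈ Finset.range X, (1 : ℝ) / 2 ≤ (expChar (q * i : ℕ) t).re := by
    intro i hi
    unfold expChar
    rw [Complex.exp_ofReal_mul_I_re, ← Real.cos_sub_int_mul_two_pi _ (a * i), ← Real.cos_abs,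
      ← Real.cos_pi_div_three]
    refine Real.cos_le_cos_of_nonneg_of_le_pi (abs_nonneg _) (by linarith [pi_pos]) ?_
    have h1 : (((q * i : ℕ) : ℤ) : ℝ) * t - ((a * i : ℤ) : ℝ) * (2 * π)
        = 2 * π * ((q * (t / (2 * π)) - a) * i) := by
      push_cast
      field_simp
    have hi' : (i : ℝ) ≤ X := by exact_mod_cast (Finset.mem_range.1 hi).le
    rw [h1, abs_mul, abs_of_pos two_pi_pos, abs_mul, Nat.abs_cast]
    have h2 : |(q : ℝ) * (t / (2 * π)) - a| * i ≤ 1 / 6 :=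
      (mul_le_mul_of_nonneg_left hi' (abs_nonneg _)).trans h
    nlinarith [pi_pos]
  calc (X : ℝ) / 2 = ∑ i ∈ Finset.range X, (1 : ℝ) / 2 := by
        rw [Finset.sum_const, Finset.card_range, nsmul_eq_mul]; ring
    _ ≤ _ := Finset.sum_le_sum this

/-- The range of denominators attached to the `j`-th dyadic level of `quadSum`. -/
def levelDenom (n j : ℕ) : ℕ := 144 * (n + 5) * 2 ^ j

/-- The length of the Dirichlet kernels attached to the `j`-th dyadic level of `quadSum`. -/
def levelLength (N : ℝ) (n j : ℕ) : ℕ := ⌊N ^ 2 / levelDenom n j⌋₊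

lemma levelDenom_pos (n j : ℕ) : 0 < levelDenom n j := by unfold levelDenom; positivity

lemma levelDenom_le_sq (N : ℝ) (n j : ℕ) (hj : j < n) (h : 12 * (n + 3) * 2 ^ n ≤ N) :
    (levelDenom n j : ℝ) ≤ N ^ 2 := by
  have h2 : (2 : ℝ) ^ j ≤ 2 ^ n := pow_le_pow_right₀ one_le_two hj.le
  have h1 : (1 : ℝ) ≤ 2 ^ n := one_le_pow₀ one_le_two
  unfold levelDenom
  push_cast
  have hn : (0 : ℝ) ≤ n := Nat.cast_nonneg n
  calc 144 * ((n : ℝ) + 5) * 2 ^ j ≤ 144 * ((n : ℝ) + 3) ^ 2 * (2 ^ n * 2 ^ n) := by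
        gcongr
        · nlinarith
        · nlinarith
    _ = (12 * (n + 3) * 2 ^ n) ^ 2 := by ring
    _ ≤ N ^ 2 := by gcongr

lemma one_le_levelLength (N : ℝ) (n j : ℕ) (hj : j < n) (h : 12 * (n + 3) * 2 ^ n ≤ N) :
    1 ≤ levelLength N n j := by
  unfold levelLength
  have : (0 : ℝ) < levelDenom n j := by exact_mod_cast levelDenom_pos n j
  rw [Nat.le_floor_iff (by positivity), le_div_iff₀ this]
  simpa using levelDenom_le_sq N n j hj h

lemma norm_quadSum_sq_le_majorant (b N t : ℝ) (n : ℕ) (hN : 1 < N) (h : 12 * (n + 3) * 2 ^ n ≤ N) :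
    ‖quadSum b N t‖ ^ 2 ≤ N ^ 2 * (4 / 2 ^ n + ∑ j ∈ Finset.range n, 4 / 2 ^ j *
      ∑ q ∈ Finset.Icc 1 (levelDenom n j), 4 / (levelLength N n j : ℝ) ^ 2 *
        ‖∑ i ∈ Finset.range (levelLength N n j), expChar (q * i : ℕ) t‖ ^ 2) := by
  have hN2 : 0 < N ^ 2 := by positivity
  have hx : ‖quadSum b N t‖ ^ 2 / N ^ 2 ≤ 4 := by
    rw [div_le_iff₀ hN2]
    calc ‖quadSum b N t‖ ^ 2 ≤ (2 * N) ^ 2 := by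
          gcongr
          exact norm_quadSum_le b N t hN
      _ = 4 * N ^ 2 := by ring
  rw [← div_le_iff₀' hN2]
  refine (le_dyadic_sum _ 4 hx (by norm_num) n).trans ?_
  gcongr with j hj
  rw [Finset.mem_range] at hj
  have hsum : ∀ q ∈ Finset.Icc 1 (levelDenom n j), 0 ≤ 4 / (levelLength N n j : ℝ) ^ 2 *
        ‖∑ i ∈ Finset.range (levelLength N n j), expChar (q * i : ℕ) t‖ ^ 2 :=
    fun q _ => by positivity
  split_ifs with hj1
  swap
  · exact Finset.sum_nonneg hsum
  rw [le_div_iff₀ hN2] at hj1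
  have hpj : (0 : ℝ) < 2 ^ j := by positivity
  have hjn : (2 : ℝ) ^ j ≤ 2 ^ n := pow_le_pow_right₀ one_le_two hj.le
  obtain ⟨q, hq0, hq, a, ha⟩ := exists_rational_approx_of_le_norm_quadSum b N t (4 / 2 ^ (j + 1))
    (n + 3) hN (by positivity) (by
      rw [div_mul_eq_mul_div, le_div_iff₀ (by positivity), pow_succ, pow_add]
      linarith) (by
      rw [div_mul_eq_mul_div, le_div_iff₀ (by positivity), pow_succ]
      push_cast
      have : 12 * ((n : ℝ) + 3) * 2 ^ j ≤ 12 * (n + 3) * 2 ^ n := by gcongr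
      linarith) hj1
  have hQ : (levelDenom n j : ℝ) = 144 * (n + 5) * 2 ^ j := by unfold levelDenom; push_cast; ring
  have hQ0 : (0 : ℝ) < levelDenom n j := by exact_mod_cast levelDenom_pos n j
  have hmem : 2 * q ∈ Finset.Icc 1 (levelDenom n j) := by
    rw [Finset.mem_Icc]
    refine ⟨by omega, ?_⟩
    have h1 : (144 : ℝ) / (4 / 2 ^ (j + 1)) = 72 * 2 ^ j := by rw [pow_succ]; field_simp; norm_num
    rw [h1] at hq
    have : ((2 * q : ℕ) : ℝ) ≤ levelDenom n j := by
      rw [hQ]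
      push_cast
      nlinarith [(Nat.cast_nonneg n : (0 : ℝ) ≤ n)]
    exact_mod_cast this
  refine le_trans ?_ (Finset.single_le_sum hsum hmem)
  have hX : (1 : ℝ) ≤ levelLength N n j := by exact_mod_cast one_le_levelLength N n j hj h
  have hXle : (levelLength N n j : ℝ) ≤ N ^ 2 / levelDenom n j := Nat.floor_le (by positivity)
  have h2 := half_le_norm_sum_expChar (2 * q) (levelLength N n j) t a (by
    have h3 : (((2 * q : ℕ) : ℝ)) * (t / (2 * π)) = q * (t / π) := by
      push_cast
      field_simp
    rw [h3]
    calc _ ≤ 24 * ((n + 3 : ℕ) + 2) / (4 / 2 ^ (j + 1) * N ^ 2) * (N ^ 2 / levelDenom n j) := by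
          gcongr
      _ = 1 / 12 := by
          rw [hQ]
          push_cast
          rw [pow_succ]
          field_simp
          ring
      _ ≤ _ := by norm_num)
  rw [div_mul_eq_mul_div, one_le_div (by positivity)]
  nlinarith

lemma sum_range_natAbs_sub_le (v : ℕ → ℝ) (hv : ∀ l, 0 ≤ v l) (X i : ℕ) (hi : i < X) :
    ∑ j ∈ Finset.range X, v ((i : ℤ) - j).natAbs ≤ v 0 + 2 * ∑ l ∈ Finset.Icc 1 X, v l := by
  have key : ∀ (T : Finset ℕ) (f : ℕ → ℕ), Set.InjOn f T → (∀ j ∈ T, f j ∈ Finset.Icc 1 X) →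
      ∑ j ∈ T, v (f j) ≤ ∑ l ∈ Finset.Icc 1 X, v l := by
    intro T f hf hT
    rw [← Finset.sum_image hf]
    refine Finset.sum_le_sum_of_subset_of_nonneg ?_ fun _ _ _ => hv _
    intro l hl
    obtain ⟨j, hj, rfl⟩ := Finset.mem_image.1 hl
    exact hT j hj
  have h0 : ∑ j ∈ Finset.range X, v ((i : ℤ) - j).natAbs
      = v 0 + (∑ j ∈ (Finset.range X).filter (· < i), v ((i : ℤ) - j).natAbs
        + ∑ j ∈ (Finset.range X).filter (i < ·), v ((i : ℤ) - j).natAbs) := by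
    rw [← Finset.add_sum_erase _ _ (Finset.mem_range.2 hi), sub_self, Int.natAbs_zero,
      ← Finset.sum_union]
    · congr 1
      refine Finset.sum_congr ?_ fun _ _ => rfl
      ext j
      simp only [Finset.mem_erase, Finset.mem_union, Finset.mem_filter]
      grind
    · rw [Finset.disjoint_filter]
      intro j _
      omega
  rw [h0, two_mul]
  gcongr
  · refine key _ _ ?_ ?_
    · intro x hx y hy hxy
      simp only [Finset.coe_filter, Set.mem_ofPred_eq, Finset.mem_range] at hx hy
      simp only at hxy
      omega
    · intro x hx
      simp only [Finset.mem_filter, Finset.mem_range] at hx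
      rw [Finset.mem_Icc]
      omega
  · refine key _ _ ?_ ?_
    · intro x hx y hy hxy
      simp only [Finset.coe_filter, Set.mem_ofPred_eq, Finset.mem_range] at hx hy
      simp only at hxy
      omega
    · intro x hx
      simp only [Finset.mem_filter, Finset.mem_range] at hx
      rw [Finset.mem_Icc]
      omega

lemma norm_integral_expChar_neg (ν : Measure ℝ) (n : ℤ) :
    ‖∫ t, expChar (-n) t ∂ν‖ = ‖∫ t, expChar n t ∂ν‖ := by
  simp_rw [← conj_expChar]
  rw [integral_conj, RCLike.norm_conj]

lemma norm_integral_expChar_natAbs (ν : Measure ℝ) (n : ℤ) :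
    ‖∫ t, expChar n.natAbs t ∂ν‖ = ‖∫ t, expChar n t ∂ν‖ := by
  rcases Int.natAbs_eq n with h | h
  · rw [← h]
  · conv_rhs => rw [h]
    rw [norm_integral_expChar_neg]

lemma integrable_comp_sub {F : Type*} [NormedAddCommGroup F] (ν : Measure ℝ) [IsFiniteMeasure ν]
    (f : ℝ → F) (hf : Continuous f) (C : ℝ) (hC : ∀ t, ‖f t‖ ≤ C) [SecondCountableTopology F] :
    Integrable (fun z : ℝ × ℝ => f (z.1 - z.2)) (ν.prod ν) :=
  Integrable.of_bound (hf.comp (by fun_prop)).aestronglyMeasurable C (ae_of_all _ fun _ => hC _)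

lemma integral_prod_norm_sum_expChar_sq_le (ν : Measure ℝ) [IsFiniteMeasure ν] (q X : ℕ) :
    ∫ z, ‖∑ i ∈ Finset.range X, expChar (q * i : ℕ) (z.1 - z.2)‖ ^ 2 ∂(ν.prod ν)
      ≤ X * (ν.real Set.univ ^ 2
        + 2 * ∑ l ∈ Finset.Icc 1 X, ‖∫ t, expChar (q * l : ℕ) t ∂ν‖ ^ 2) := by
  set v : ℕ → ℝ := fun l => ‖∫ t, expChar (q * l : ℕ) t ∂ν‖ ^ 2 with hv
  have h1 : ((∫ z, ‖∑ i ∈ Finset.range X, expChar (q * i : ℕ) (z.1 - z.2)‖ ^ 2 ∂(ν.prod ν) : ℝ) : ℂ)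
      = ∑ i ∈ Finset.range X, ∑ j ∈ Finset.range X, (v ((i : ℤ) - j).natAbs : ℂ) := by
    rw [← integral_complex_ofReal]
    have h2 : ∀ z : ℝ × ℝ, ((‖∑ i ∈ Finset.range X, expChar (q * i : ℕ) (z.1 - z.2)‖ ^ 2 : ℝ) : ℂ)
        = ∑ i ∈ Finset.range X, ∑ j ∈ Finset.range X, expChar (q * ((i : ℤ) - j)) (z.1 - z.2) := by
      intro z
      rw [norm_sum_sq_eq]
      refine Finset.sum_congr rfl fun i _ => Finset.sum_congr rfl fun j _ => ?_
      rw [conj_expChar, ← expChar_add]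
      congr 1
      push_cast
      ring
    simp_rw [h2]
    have hInt : ∀ m : ℤ, Integrable (fun z : ℝ × ℝ => expChar m (z.1 - z.2)) (ν.prod ν) := fun m =>
      integrable_comp_sub ν _ (continuous_expChar m) 1 fun t => (norm_expChar m t).le
    rw [integral_finsetSum _ fun i _ => integrable_finsetSum _ fun j _ => hInt _]
    refine Finset.sum_congr rfl fun i _ => ?_
    rw [integral_finsetSum _ fun j _ => hInt _]
    refine Finset.sum_congr rfl fun j _ => ?_
    set m : ℤ := (i : ℤ) - j
    simp_rw [expChar_sub_right]
    rw [integral_prod_mul]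
    have h3 : ∫ t, expChar (-(q * m)) t ∂ν = (starRingEnd ℂ) (∫ t, expChar (q * m) t ∂ν) := by
      simp_rw [← conj_expChar]
      rw [integral_conj]
    rw [h3, Complex.mul_conj', hv]
    simp only
    rw [← Complex.ofReal_pow, ← norm_integral_expChar_natAbs, Int.natAbs_mul, Int.natAbs_natCast]
  have h2 : ∫ z, ‖∑ i ∈ Finset.range X, expChar (q * i : ℕ) (z.1 - z.2)‖ ^ 2 ∂(ν.prod ν)
      = ∑ i ∈ Finset.range X, ∑ j ∈ Finset.range X, v ((i : ℤ) - j).natAbs := by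
    exact_mod_cast h1
  rw [h2]
  have hv0 : v 0 = ν.real Set.univ ^ 2 := by
    simp [hv, expChar]
  calc _ ≤ ∑ i ∈ Finset.range X, (v 0 + 2 * ∑ l ∈ Finset.Icc 1 X, v l) :=
        Finset.sum_le_sum fun i hi => sum_range_natAbs_sub_le v (fun l => by positivity) X i
          (Finset.mem_range.1 hi)
    _ = _ := by rw [Finset.sum_const, Finset.card_range, nsmul_eq_mul, hv0]

lemma sum_Icc_norm_sq_integral_expChar_le (E : Set ℝ) (hE : E ⊆ Set.Ioc 0 (2 * π)) (M : ℕ) :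
    ∑ n ∈ Finset.Icc 1 M, ‖∫ t in E, expChar n t‖ ^ 2 ≤ 2 * π * volume.real E := by
  have := sum_norm_sq_integral_expChar_le E hE ((Finset.Icc 1 M).map Nat.castEmbedding)
  rw [Finset.sum_map] at this
  exact this

lemma sum_integral_prod_level_le (E : Set ℝ) (hE : E ⊆ Set.Ioc 0 (2 * π)) (Q X k : ℕ) (hQ : 1 ≤ Q)
    (hX : 1 ≤ X) (D : ℝ) (hD : 0 < D) :
    ∑ q ∈ Finset.Icc 1 Q, 4 / (X : ℝ) ^ 2 *
      ∫ z, ‖∑ i ∈ Finset.range X, expChar (q * i : ℕ) (z.1 - z.2)‖ ^ 2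
        ∂((volume.restrict E).prod (volume.restrict E))
      ≤ 4 * Q / X * volume.real E ^ 2 + 16 * π * D / X * volume.real E
        + 8 * volume.real E ^ 2 * Q * (∑ q ∈ Finset.Icc 1 Q, (1 : ℝ) / q) ^ 2 ^ (k + 1) / D ^ k := by
  have hfin : volume E ≠ ⊤ := measure_ne_top_of_subset hE measure_Ioc_lt_top.ne
  have : IsFiniteMeasure (volume.restrict E) := ⟨by simpa using hfin.lt_top⟩
  set m := volume.real E with hm
  set u : ℕ → ℝ := fun n => ‖∫ t in E, expChar n t‖ ^ 2 with hu
  have hX' : (0 : ℝ) < X := by exact_mod_cast hX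
  have huB : ∀ n, u n ≤ m ^ 2 := fun n => by
    have : ‖∫ t in E, expChar n t‖ ≤ 1 * volume.real E :=
      norm_setIntegral_le_of_norm_le_const hfin.lt_top fun t _ => (norm_expChar _ t).le
    rw [one_mul] at this
    simp only [hu]
    gcongr
  have h1 := sum_sum_mul_le u (m ^ 2) (fun n => by positivity) huB Q X k hQ D hD
  have h2 : ∑ n ∈ Finset.Icc 1 (Q * X), u n ≤ 2 * π * m :=
    sum_Icc_norm_sq_integral_expChar_le E hE _
  set H := (∑ q ∈ Finset.Icc 1 Q, (1 : ℝ) / q) ^ 2 ^ (k + 1)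
  calc _ ≤ ∑ q ∈ Finset.Icc 1 Q, 4 / (X : ℝ) ^ 2 *
        (X * (m ^ 2 + 2 * ∑ l ∈ Finset.Icc 1 X, u (q * l))) := by
        gcongr with q _
        have := integral_prod_norm_sum_expChar_sq_le (volume.restrict E) q X
        simp only [measureReal_restrict_apply_univ] at this
        exact this
    _ = 4 / X * (Q * m ^ 2 + 2 * ∑ q ∈ Finset.Icc 1 Q, ∑ l ∈ Finset.Icc 1 X, u (q * l)) := by
        rw [← Finset.mul_sum, ← Finset.mul_sum, Finset.sum_add_distrib, Finset.sum_const,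
          Nat.card_Icc, ← Finset.mul_sum, nsmul_eq_mul]
        simp only [Nat.add_sub_cancel]
        field_simp
    _ ≤ 4 / X * (Q * m ^ 2 + 2 * (D * (2 * π * m) + m ^ 2 * (Q * X) * H / D ^ k)) := by
        gcongr
        refine h1.trans ?_
        gcongr
    _ = _ := by
        field_simp
        ring

lemma exists_pow_le_two_rpow (K : ℕ) (ε : ℝ) (hε : 0 < ε) :
    ∃ C : ℝ, 0 < C ∧ ∀ n : ℕ, (2 * (n : ℝ) + 14) ^ K ≤ C * 2 ^ (ε * n) := by
  set c := ε * Real.log 2 / (2 * (K + 1)) with hc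
  have hl : 0 < Real.log 2 := Real.log_pos one_lt_two
  have hc0 : 0 < c := by positivity
  refine ⟨(1 / c) ^ K * Real.exp (7 * (ε * Real.log 2)), by positivity, fun n => ?_⟩
  have h1 : 2 * (n : ℝ) + 14 ≤ 1 / c * Real.exp (c * (2 * n + 14)) := by
    rw [one_div, ← div_le_iff₀' (by positivity), div_inv_eq_mul]
    linarith [Real.add_one_le_exp (c * (2 * n + 14))]
  have h2 : K * (c * (2 * n + 14)) ≤ 7 * (ε * Real.log 2) + ε * n * Real.log 2 := by
    have h3 : K * c ≤ ε * Real.log 2 / 2 := by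
      rw [hc, mul_div_assoc', div_le_div_iff₀ (by positivity) (by norm_num)]
      nlinarith [mul_pos hε hl]
    calc K * (c * (2 * n + 14)) = K * c * (2 * n + 14) := by ring
      _ ≤ ε * Real.log 2 / 2 * (2 * n + 14) := by gcongr
      _ = _ := by ring
  calc (2 * (n : ℝ) + 14) ^ K ≤ (1 / c * Real.exp (c * (2 * n + 14))) ^ K := by gcongr
    _ = (1 / c) ^ K * Real.exp (K * (c * (2 * n + 14))) := by rw [mul_pow, Real.exp_nat_mul]
    _ ≤ (1 / c) ^ K * Real.exp (7 * (ε * Real.log 2) + ε * n * Real.log 2) := by gcongr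
    _ = _ := by
        rw [Real.exp_add, Real.rpow_def_of_pos two_pos]
        ring_nf

lemma sum_inv_levelDenom_le (n j : ℕ) (hj : j < n) :
    ∑ q ∈ Finset.Icc 1 (levelDenom n j), (1 : ℝ) / q ≤ 2 * n + 14 := by
  have h1 := harmonic_le_one_add_log (levelDenom n j)
  rw [harmonic_eq_sum_Icc] at h1
  push_cast at h1
  simp_rw [one_div]
  refine h1.trans ?_
  have h2 : levelDenom n j ≤ 2 ^ (2 * n + 13) := by
    unfold levelDenom
    have h3 : n + 5 ≤ 2 ^ (n + 5) := Nat.lt_two_pow_self.le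
    have h4 : 2 ^ j ≤ 2 ^ n := Nat.pow_le_pow_right (by norm_num) hj.le
    calc 144 * (n + 5) * 2 ^ j ≤ 2 ^ 8 * 2 ^ (n + 5) * 2 ^ n := by gcongr; norm_num
      _ = 2 ^ (2 * n + 13) := by rw [← pow_add, ← pow_add]; congr 1; omega
  have h5 : Real.log (levelDenom n j) ≤ 2 * n + 13 := by
    calc Real.log (levelDenom n j) ≤ Real.log ((2 : ℝ) ^ (2 * n + 13)) := by
          apply Real.log_le_log
          · exact_mod_cast levelDenom_pos n j
          · exact_mod_cast h2
      _ = (2 * n + 13) * Real.log 2 := by rw [Real.log_pow]; push_cast; ring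
      _ ≤ (2 * n + 13) * 1 := by
          gcongr
          linarith [Real.log_two_lt_d9]
      _ = _ := mul_one _
  linarith

lemma integral_prod_norm_quadSum_sq_le (ε : ℝ) (hε : 0 < ε) :
    ∃ C : ℝ, 0 < C ∧ ∀ (b N : ℝ) (n : ℕ) (E : Set ℝ), 1 < N → 12 * (n + 3) * 2 ^ n ≤ N →
      E ⊆ Set.Ioc 0 (2 * π) →
      ∫ z, ‖quadSum b N (z.1 - z.2)‖ ^ 2 ∂((volume.restrict E).prod (volume.restrict E))
        ≤ C * (N ^ 2 / 2 ^ n * volume.real E ^ 2 + 2 ^ (ε * n) * volume.real E) := by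
  set k := ⌈4 / ε⌉₊ with hk
  set K := 2 ^ (k + 1) with hK
  obtain ⟨C₁, hC₁, h₁⟩ := exists_pow_le_two_rpow 2 (ε / 2) (by positivity)
  obtain ⟨C₂, hC₂, h₂⟩ := exists_pow_le_two_rpow (2 + K) 1 one_pos
  refine ⟨4 + 18432 + 18432 * π * C₁ + 4608 * C₂, by positivity, ?_⟩
  intro b N n E hN hn hE
  have hfin : volume E ≠ ⊤ := measure_ne_top_of_subset hE measure_Ioc_lt_top.ne
  have : IsFiniteMeasure (volume.restrict E) := ⟨by simpa using hfin.lt_top⟩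
  set m := volume.real E with hm
  have hm0 : 0 ≤ m := measureReal_nonneg
  have hN2 : 0 < N ^ 2 := by positivity
  set D : ℝ := 2 ^ (ε / 2 * n) with hD
  have hD0 : 0 < D := by positivity
  have hDk : (2 : ℝ) ^ n * 2 ^ n ≤ D ^ k := by
    rw [hD, ← Real.rpow_natCast, ← Real.rpow_natCast, ← Real.rpow_mul two_pos.le,
      ← Real.rpow_add two_pos]
    apply Real.rpow_le_rpow_of_exponent_le one_le_two
    have : 4 / ε ≤ k := Nat.le_ceil _
    rw [div_le_iff₀ hε] at this
    nlinarith [(Nat.cast_nonneg n : (0 : ℝ) ≤ n)]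
  set y : ℝ := 2 * n + 14 with hy
  have hn0 : (0 : ℝ) ≤ n := Nat.cast_nonneg n
  have hy1 : (n : ℝ) ≤ y := by linarith
  have hy5 : (n : ℝ) + 5 ≤ y := by linarith
  have hy0 : 0 < y := by linarith
  set W : ℕ → ℕ → ℝ := fun j q => ∫ z, ‖∑ i ∈ Finset.range (levelLength N n j),
    expChar (q * i : ℕ) (z.1 - z.2)‖ ^ 2 ∂((volume.restrict E).prod (volume.restrict E)) with hW
  have hInt : ∀ X q : ℕ, Integrable (fun z : ℝ × ℝ =>
      ‖∑ i ∈ Finset.range X, expChar (q * i : ℕ) (z.1 - z.2)‖ ^ 2)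
      ((volume.restrict E).prod (volume.restrict E)) := fun X q => by
    refine integrable_comp_sub (volume.restrict E) (fun t => ‖∑ i ∈ Finset.range X,
      expChar (q * i : ℕ) t‖ ^ 2) ?_ ((X : ℝ) ^ 2) fun t => ?_
    · exact (continuous_finsetSum _ fun i _ => continuous_expChar _).norm.pow 2
    · rw [norm_pow, norm_norm]
      gcongr
      exact (norm_sum_le_of_le _ (n := fun _ => (1 : ℝ)) fun i _ => (norm_expChar _ _).le).trans
        (by simp)
  have hintl : Integrable (fun z : ℝ × ℝ => ‖quadSum b N (z.1 - z.2)‖ ^ 2)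
      ((volume.restrict E).prod (volume.restrict E)) := by
    refine integrable_comp_sub (volume.restrict E) (fun t => ‖quadSum b N t‖ ^ 2) ?_
      ((2 * N) ^ 2) fun t => ?_
    · unfold quadSum
      fun_prop
    · rw [norm_pow, norm_norm]
      gcongr
      exact norm_quadSum_le b N t hN
  have hmain : ∫ z, ‖quadSum b N (z.1 - z.2)‖ ^ 2 ∂((volume.restrict E).prod (volume.restrict E))
      ≤ N ^ 2 * (4 / 2 ^ n * m ^ 2 + ∑ j ∈ Finset.range n, 4 / 2 ^ j *
      ∑ q ∈ Finset.Icc 1 (levelDenom n j), 4 / (levelLength N n j : ℝ) ^ 2 * W j q) := by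
    have hint2 : ∀ j, Integrable (fun z : ℝ × ℝ => 4 / 2 ^ j *
      ∑ q ∈ Finset.Icc 1 (levelDenom n j), 4 / (levelLength N n j : ℝ) ^ 2 *
        ‖∑ i ∈ Finset.range (levelLength N n j), expChar (q * i : ℕ) (z.1 - z.2)‖ ^ 2)
        ((volume.restrict E).prod (volume.restrict E)) := fun j =>
      (integrable_finsetSum _ fun q _ => (hInt _ _).const_mul _).const_mul _
    have hint3 := integrable_finsetSum (Finset.range n) fun j _ => hint2 j
    refine (integral_mono hintl (((integrable_const _).add hint3).const_mul _)
      fun z => norm_quadSum_sq_le_majorant b N (z.1 - z.2) n hN hn).trans (le_of_eq ?_)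
    simp only [Pi.add_apply]
    rw [integral_const_mul, integral_add (integrable_const _) hint3,
      integral_finsetSum _ fun j _ => hint2 j]
    congr 2
    · rw [integral_const, ← Set.univ_prod_univ, measureReal_prod_prod]
      simp only [measureReal_restrict_apply_univ, smul_eq_mul]
      ring
    · refine Finset.sum_congr rfl fun j _ => ?_
      rw [integral_const_mul, integral_finsetSum _ fun q _ => (hInt _ _).const_mul _]
      simp_rw [integral_const_mul]
      rfl
  have hlevel : ∀ j ∈ Finset.range n, 4 / 2 ^ j *
      ∑ q ∈ Finset.Icc 1 (levelDenom n j), 4 / (levelLength N n j : ℝ) ^ 2 * W j q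
      ≤ 18432 / (2 ^ n * 2 ^ n) * m ^ 2 * 2 ^ j + (18432 * π * y * D / N ^ 2 * m
        + 4608 * y ^ (1 + K) / (2 ^ n * 2 ^ n) * m ^ 2) := by
    intro j hj
    rw [Finset.mem_range] at hj
    have hQ : (levelDenom n j : ℝ) = 144 * (n + 5) * 2 ^ j := by unfold levelDenom; push_cast; ring
    have hQ0 : (0 : ℝ) < levelDenom n j := by exact_mod_cast levelDenom_pos n j
    have hX1 := one_le_levelLength N n j hj hn
    have hX : (1 : ℝ) ≤ levelLength N n j := by exact_mod_cast hX1
    have h3 := sum_integral_prod_level_le E hE (levelDenom n j) (levelLength N n j) k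
      (levelDenom_pos n j) hX1 D hD0
    have hXinv : 1 / (levelLength N n j : ℝ) ≤ 2 * levelDenom n j / N ^ 2 := by
      rw [div_le_div_iff₀ (by linarith) hN2, one_mul]
      have h4 : N ^ 2 / levelDenom n j < levelLength N n j + 1 := Nat.lt_floor_add_one _
      rw [div_lt_iff₀ hQ0] at h4
      nlinarith
    have hH : (∑ q ∈ Finset.Icc 1 (levelDenom n j), (1 : ℝ) / q) ^ 2 ^ (k + 1) ≤ y ^ K :=
      pow_le_pow_left₀ (by positivity) (sum_inv_levelDenom_le n j hj) _
    have hNlow : 36 * ((n : ℝ) + 5) ^ 2 * (2 ^ n * 2 ^ n) ≤ N ^ 2 := by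
      calc 36 * ((n : ℝ) + 5) ^ 2 * (2 ^ n * 2 ^ n)
          ≤ 36 * (2 * ((n : ℝ) + 3)) ^ 2 * ((2 : ℝ) ^ n * 2 ^ n) := by gcongr; linarith
        _ = (12 * ((n : ℝ) + 3) * 2 ^ n) ^ 2 := by ring
        _ ≤ _ := by gcongr
    have e1 : 4 / 2 ^ j * (4 * levelDenom n j / levelLength N n j * m ^ 2)
        ≤ 18432 / (2 ^ n * 2 ^ n) * m ^ 2 * 2 ^ j := by
      calc 4 / 2 ^ j * (4 * levelDenom n j / levelLength N n j * m ^ 2)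
          = 4 / 2 ^ j * (4 * levelDenom n j * (1 / levelLength N n j) * m ^ 2) := by ring
        _ ≤ 4 / 2 ^ j * (4 * levelDenom n j * (2 * levelDenom n j / N ^ 2) * m ^ 2) := by gcongr
        _ = 663552 * (n + 5) ^ 2 / N ^ 2 * (2 ^ j * m ^ 2) := by rw [hQ]; field_simp; ring
        _ ≤ 18432 / (2 ^ n * 2 ^ n) * (2 ^ j * m ^ 2) := by
            gcongr ?_ * _
            rw [div_le_div_iff₀ hN2 (by positivity)]
            nlinarith
        _ = _ := by ring
    have e2 : 4 / 2 ^ j * (16 * π * D / levelLength N n j * m) ≤ 18432 * π * y * D / N ^ 2 * m := by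
      calc 4 / 2 ^ j * (16 * π * D / levelLength N n j * m)
          = 4 / 2 ^ j * (16 * π * D * (1 / levelLength N n j) * m) := by ring
        _ ≤ 4 / 2 ^ j * (16 * π * D * (2 * levelDenom n j / N ^ 2) * m) := by gcongr
        _ = 18432 * π * (n + 5) * D / N ^ 2 * m := by rw [hQ]; field_simp; ring
        _ ≤ _ := by gcongr
    have e3 : 4 / 2 ^ j * (8 * m ^ 2 * levelDenom n j *
        (∑ q ∈ Finset.Icc 1 (levelDenom n j), (1 : ℝ) / q) ^ 2 ^ (k + 1) / D ^ k)
        ≤ 4608 * y ^ (1 + K) / (2 ^ n * 2 ^ n) * m ^ 2 := by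
      calc _ ≤ 4 / 2 ^ j * (8 * m ^ 2 * levelDenom n j * y ^ K / (2 ^ n * 2 ^ n)) := by gcongr
        _ = 4608 * ((n + 5) * y ^ K) / (2 ^ n * 2 ^ n) * m ^ 2 := by rw [hQ]; field_simp; ring
        _ ≤ _ := by
            rw [pow_add, pow_one]
            gcongr
    rw [← hm] at h3
    refine (mul_le_mul_of_nonneg_left h3 (by positivity)).trans ?_
    rw [mul_add, mul_add]
    linarith
  have hgeom : ∑ j ∈ Finset.range n, (2 : ℝ) ^ j ≤ 2 ^ n := by
    rw [geom_sum_eq (by norm_num)]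
    norm_num
  have hsum := Finset.sum_le_sum hlevel
  rw [Finset.sum_add_distrib, ← Finset.mul_sum, Finset.sum_const, Finset.card_range,
    nsmul_eq_mul] at hsum
  have h2n : (0 : ℝ) < 2 ^ n := by positivity
  have f1 : 18432 / (2 ^ n * 2 ^ n) * m ^ 2 * ∑ j ∈ Finset.range n, (2 : ℝ) ^ j
      ≤ 18432 / 2 ^ n * m ^ 2 := by
    calc _ ≤ 18432 / (2 ^ n * 2 ^ n) * m ^ 2 * (2 : ℝ) ^ n := by gcongr
      _ = _ := by field_simp
  have f2 : n * (18432 * π * y * D / N ^ 2 * m) ≤ 18432 * π * C₁ * 2 ^ (ε * n) / N ^ 2 * m := by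
    have : n * y * D ≤ C₁ * 2 ^ (ε * n) := by
      calc n * y * D ≤ y ^ 2 * D := by rw [sq]; gcongr
        _ ≤ C₁ * 2 ^ (ε / 2 * n) * D := by gcongr; exact h₁ n
        _ = C₁ * 2 ^ (ε * n) := by
            rw [hD, mul_assoc, ← Real.rpow_add two_pos]
            ring_nf
    calc n * (18432 * π * y * D / N ^ 2 * m) = 18432 * π * (n * y * D) / N ^ 2 * m := by ring
      _ ≤ 18432 * π * (C₁ * 2 ^ (ε * n)) / N ^ 2 * m := by gcongr
      _ = _ := by ring
  have f3 : n * (4608 * y ^ (1 + K) / (2 ^ n * 2 ^ n) * m ^ 2) ≤ 4608 * C₂ / 2 ^ n * m ^ 2 := by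
    have : n * y ^ (1 + K) ≤ C₂ * 2 ^ n := by
      calc n * y ^ (1 + K) ≤ y * y ^ (1 + K) := by gcongr
        _ = y ^ (2 + K) := by ring
        _ ≤ C₂ * 2 ^ ((1 : ℝ) * n) := h₂ n
        _ = _ := by rw [one_mul, Real.rpow_natCast]
    calc n * (4608 * y ^ (1 + K) / (2 ^ n * 2 ^ n) * m ^ 2)
        = 4608 * (n * y ^ (1 + K)) / (2 ^ n * 2 ^ n) * m ^ 2 := by ring
      _ ≤ 4608 * (C₂ * 2 ^ n) / (2 ^ n * 2 ^ n) * m ^ 2 := by gcongr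
      _ = _ := by field_simp
  calc _ ≤ _ := hmain
    _ ≤ N ^ 2 * (4 / 2 ^ n * m ^ 2 + (18432 / 2 ^ n * m ^ 2
          + (18432 * π * C₁ * 2 ^ (ε * n) / N ^ 2 * m + 4608 * C₂ / 2 ^ n * m ^ 2))) := by
        gcongr
        rw [mul_add] at hsum
        linarith
    _ = (4 + 18432 + 4608 * C₂) * (N ^ 2 / 2 ^ n * m ^ 2)
        + 18432 * π * C₁ * (2 ^ (ε * n) * m) := by
        field_simp
        ring
    _ ≤ (4 + 18432 + 18432 * π * C₁ + 4608 * C₂) * (N ^ 2 / 2 ^ n * m ^ 2)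
        + (4 + 18432 + 18432 * π * C₁ + 4608 * C₂) * (2 ^ (ε * n) * m) := by
        gcongr ?_ * _ + ?_ * _
        · linarith [mul_pos pi_pos hC₁]
        · linarith
    _ = _ := by ring

lemma sq_mul_measureReal_sq_le {ι : Type*} (S : Finset ι) (φ : ι → ℤ) (a : ι → ℂ) (E : Set ℝ)
    (hE : E ⊆ Set.Ioc 0 (2 * π)) (hEm : MeasurableSet E) (l : ℝ) (hl : 0 ≤ l)
    (hF : ∀ t ∈ E, l ≤ ‖∑ i ∈ S, a i * expChar (φ i) t‖) :
    l ^ 2 * volume.real E ^ 2 ≤ (∑ i ∈ S, ‖a i‖ ^ 2) *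
      ∫ z, ‖∑ i ∈ S, expChar (φ i) (z.1 - z.2)‖
        ∂((volume.restrict E).prod (volume.restrict E)) := by
  have hfin : volume E ≠ ⊤ := measure_ne_top_of_subset hE measure_Ioc_lt_top.ne
  set ν := volume.restrict E with hν
  have : IsFiniteMeasure ν := ⟨by simpa [hν] using hfin.lt_top⟩
  set F : ℝ → ℂ := fun t => ∑ i ∈ S, a i * expChar (φ i) t with hFdef
  have hFc : Continuous F := continuous_finsetSum _ fun i _ =>
    continuous_const.mul (continuous_expChar _)
  set g : ℝ → ℂ := fun t => (starRingEnd ℂ) (F t) / (‖F t‖ : ℂ) with hg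
  have hgm : Measurable g := by
    have h1 : Measurable fun t => (starRingEnd ℂ) (F t) :=
      (Complex.continuous_conj.comp hFc).measurable
    have h2 : Measurable fun t => (‖F t‖ : ℂ) :=
      (Complex.continuous_ofReal.comp hFc.norm).measurable
    exact h1.div h2
  have hg1 : ∀ t, ‖g t‖ ≤ 1 := fun t => by
    simp only [hg, norm_div, RCLike.norm_conj, Complex.norm_real, norm_norm]
    exact div_self_le_one _
  have hgF : ∀ t, g t * F t = (‖F t‖ : ℂ) := fun t => by
    simp only [hg]
    rw [div_mul_eq_mul_div, Complex.conj_mul', sq]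
    exact mul_self_div_self _
  have hgint : ∀ n : ℤ, Integrable (fun t => g t * expChar n t) ν := fun n =>
    Integrable.of_bound (hgm.mul (continuous_expChar n).measurable).aestronglyMeasurable 1
      (ae_of_all _ fun t => by rw [norm_mul, norm_expChar, mul_one]; exact hg1 t)
  set c : ι → ℂ := fun i => ∫ t, g t * expChar (φ i) t ∂ν with hc
  have h1 : l * volume.real E ≤ ‖∑ i ∈ S, a i * c i‖ := by
    have h2 : ∑ i ∈ S, a i * c i = ((∫ t, ‖F t‖ ∂ν : ℝ) : ℂ) := by
      rw [← integral_complex_ofReal]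
      simp_rw [← hgF, hFdef, Finset.mul_sum]
      rw [integral_finsetSum]
      · refine Finset.sum_congr rfl fun i _ => ?_
        rw [hc, ← integral_const_mul]
        congr 1
        ext t
        ring
      · intro i _
        convert (hgint (φ i)).const_mul (a i) using 2
        ring
    rw [h2, Complex.norm_real, Real.norm_of_nonneg (integral_nonneg fun _ => norm_nonneg _)]
    calc l * volume.real E = ∫ t, l ∂ν := by
          rw [integral_const, smul_eq_mul, hν, measureReal_restrict_apply_univ, mul_comm]
      _ ≤ ∫ t, ‖F t‖ ∂ν := by
          refine setIntegral_mono_on (integrable_const _) ?_ hEm hF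
          exact (hFc.norm.integrableOn_Icc.mono_set Set.Ioc_subset_Icc_self).mono_set hE
  have h3 : ‖∑ i ∈ S, a i * c i‖ ^ 2 ≤ (∑ i ∈ S, ‖a i‖ ^ 2) * ∑ i ∈ S, ‖c i‖ ^ 2 := by
    refine le_trans ?_ (Finset.sum_mul_sq_le_sq_mul_sq S (fun i => ‖a i‖) fun i => ‖c i‖)
    gcongr
    exact norm_sum_le_of_le _ fun i _ => (norm_mul _ _).le
  have h4 : ∑ i ∈ S, ‖c i‖ ^ 2 ≤ ∫ z, ‖∑ i ∈ S, expChar (φ i) (z.1 - z.2)‖ ∂(ν.prod ν) := by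
    have h5 : ((∑ i ∈ S, ‖c i‖ ^ 2 : ℝ) : ℂ)
        = ∫ z, g z.1 * (starRingEnd ℂ) (g z.2) * ∑ i ∈ S, expChar (φ i) (z.1 - z.2) ∂(ν.prod ν) := by
      simp_rw [Finset.mul_sum]
      have h6 : ∀ i, (fun z : ℝ × ℝ =>
          g z.1 * (starRingEnd ℂ) (g z.2) * expChar (φ i) (z.1 - z.2))
          = fun z : ℝ × ℝ => (g z.1 * expChar (φ i) z.1) *
            (starRingEnd ℂ) (g z.2 * expChar (φ i) z.2) := fun i => by
        ext z
        rw [map_mul, conj_expChar, expChar_sub_right]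
        ring
      have h7 : ∀ i, Integrable (fun t => (starRingEnd ℂ) (g t * expChar (φ i) t)) ν := fun i =>
        (Complex.conjCLE : ℂ →L[ℝ] ℂ).integrable_comp (hgint (φ i))
      rw [integral_finsetSum]
      · push_cast
        refine Finset.sum_congr rfl fun i _ => ?_
        rw [h6, integral_prod_mul (fun t => g t * expChar (φ i) t)
          (fun t => (starRingEnd ℂ) (g t * expChar (φ i) t)), integral_conj, Complex.mul_conj']
      · intro i _
        rw [h6]
        exact (hgint (φ i)).mul_prod (h7 i)
    have h8 : ∑ i ∈ S, ‖c i‖ ^ 2 = ‖((∑ i ∈ S, ‖c i‖ ^ 2 : ℝ) : ℂ)‖ := by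
      rw [Complex.norm_real, Real.norm_of_nonneg (by positivity)]
    rw [h8, h5]
    refine norm_integral_le_of_norm_le ?_ (ae_of_all _ fun z => ?_)
    · refine integrable_comp_sub ν (fun t => ‖∑ i ∈ S, expChar (φ i) t‖) ?_ S.card fun t => ?_
      · exact (continuous_finsetSum _ fun i _ => continuous_expChar _).norm
      · rw [norm_norm]
        exact (norm_sum_le_of_le _ (n := fun _ => (1 : ℝ)) fun i _ => (norm_expChar _ _).le).trans
          (by simp)
    · rw [norm_mul, norm_mul, RCLike.norm_conj]
      have : ‖g z.1‖ * ‖g z.2‖ ≤ 1 := mul_le_one₀ (hg1 _) (norm_nonneg _) (hg1 _)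
      exact mul_le_of_le_one_left (norm_nonneg _) this
  calc l ^ 2 * volume.real E ^ 2 = (l * volume.real E) ^ 2 := by ring
    _ ≤ ‖∑ i ∈ S, a i * c i‖ ^ 2 := by gcongr
    _ ≤ _ := h3
    _ ≤ _ := by gcongr

/-- The frequency `-|ξ|²` of the lattice point `ξ`. -/
def boxFreq {r : ℕ} (ξ : Fin r → ℤ) : ℤ := -∑ i, ξ i ^ 2

lemma cexp_eq_expChar {r : ℕ} (ξ : Fin r → ℤ) (t : ℝ) :
    Complex.exp (-(Complex.I * (t : ℂ) * (eNormSq ξ : ℂ))) = expChar (boxFreq ξ) t := by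
  unfold expChar eNormSq boxFreq
  push_cast
  ring_nf

lemma sum_expChar_boxFreq (r : ℕ) (b : Fin r → ℝ) (N t : ℝ) :
    ∑ ξ ∈ latticeBox r b N, expChar (boxFreq ξ) t = ∏ i, quadSum (b i) N t := by
  unfold quadSum latticeBox
  rw [Finset.prod_univ_sum]
  refine Finset.sum_congr rfl fun ξ _ => ?_
  rw [← cexp_eq_expChar, ← Complex.exp_sum]
  unfold eNormSq
  push_cast
  rw [Finset.mul_sum, ← Finset.sum_neg_distrib]

/-- The critical exponent of the weak-type estimate in dimension `r`. -/
def critExp (r : ℕ) : ℕ := if r = 1 then 4 else 2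

lemma integrable_norm_quadSum_pow (ν : Measure ℝ) [IsFiniteMeasure ν] (b N : ℝ) (hN : 1 < N)
    (k : ℕ) : Integrable (fun z : ℝ × ℝ => ‖quadSum b N (z.1 - z.2)‖ ^ k) (ν.prod ν) := by
  refine integrable_comp_sub ν (fun t => ‖quadSum b N t‖ ^ k) ?_ ((2 * N) ^ k) fun t => ?_
  · unfold quadSum
    fun_prop
  · rw [norm_pow, norm_norm]
    gcongr
    exact norm_quadSum_le b N t hN

lemma pow_critExp_mul_le (r : ℕ) (hr : 1 ≤ r) (b : Fin r → ℝ) (N : ℝ) (hN : 1 < N)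
    (a : (Fin r → ℤ) → ℂ) (ha : 0 < ∑ ξ ∈ latticeBox r b N, ‖a ξ‖ ^ 2) (δ : ℝ) (hδ : 0 < δ)
    (E : Set ℝ) (hE : E ⊆ Set.Ioc 0 (2 * π)) (hEm : MeasurableSet E)
    (hF : ∀ t ∈ E, δ ^ 2 * N ^ r * ∑ ξ ∈ latticeBox r b N, ‖a ξ‖ ^ 2
      ≤ ‖∑ ξ ∈ latticeBox r b N, a ξ * expChar (boxFreq ξ) t‖ ^ 2) (W : ℝ)
    (hW : ∀ i, ∫ z, ‖quadSum (b i) N (z.1 - z.2)‖ ^ 2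
      ∂((volume.restrict E).prod (volume.restrict E)) ≤ W) :
    δ ^ critExp r / 2 ^ r * (N ^ 2 * volume.real E ^ 2) ≤ W := by
  have hfin : volume E ≠ ⊤ := measure_ne_top_of_subset hE measure_Ioc_lt_top.ne
  set ν := volume.restrict E with hν
  have : IsFiniteMeasure ν := ⟨by simpa [hν] using hfin.lt_top⟩
  set m := volume.real E with hm
  set A2 := ∑ ξ ∈ latticeBox r b N, ‖a ξ‖ ^ 2 with hA2
  have hm0 : 0 ≤ m := measureReal_nonneg
  have hW0 : 0 ≤ W := le_trans (integral_nonneg fun z => by positivity) (hW ⟨0, hr⟩)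
  have hN0 : 0 < N := by linarith
  set V := ∫ z, ‖∏ i, quadSum (b i) N (z.1 - z.2)‖ ∂(ν.prod ν) with hV
  have h1 : δ ^ 2 * N ^ r * m ^ 2 ≤ V := by
    have h2 := sq_mul_measureReal_sq_le (latticeBox r b N) boxFreq a E hE hEm
      (√(δ ^ 2 * N ^ r * A2)) (Real.sqrt_nonneg _) fun t ht => by
        rw [← Real.sqrt_sq (norm_nonneg (∑ ξ ∈ latticeBox r b N, a ξ * expChar (boxFreq ξ) t))]
        exact Real.sqrt_le_sqrt (hF t ht)
    rw [Real.sq_sqrt (by positivity)] at h2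
    simp_rw [sum_expChar_boxFreq] at h2
    refine le_of_mul_le_mul_left ?_ ha
    calc A2 * (δ ^ 2 * N ^ r * m ^ 2) = δ ^ 2 * N ^ r * A2 * m ^ 2 := by ring
      _ ≤ _ := h2
  have hV0 : 0 ≤ V := integral_nonneg fun z => norm_nonneg _
  rcases hr.eq_or_lt with rfl | hr2
  · have hc : critExp 1 = 4 := rfl
    rw [hc]
    simp only [Fin.prod_univ_one, pow_one] at hV h1 ⊢
    rcases hm0.eq_or_lt with h0 | h0
    · rw [← h0]; simpa using hW0
    set x := δ ^ 2 * N / 2 with hx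
    have hx0 : 0 < x := by positivity
    have h3 : V ≤ x * m ^ 2 + (4 * x)⁻¹ * W := by
      calc V ≤ ∫ z, (x + (4 * x)⁻¹ * ‖quadSum (b 0) N (z.1 - z.2)‖ ^ 2) ∂(ν.prod ν) := by
            rw [hV]
            refine integral_mono ?_ ((integrable_const _).add
              ((integrable_norm_quadSum_pow ν (b 0) N hN 2).const_mul _)) fun z => ?_
            · simpa using integrable_norm_quadSum_pow ν (b 0) N hN 1
            · have h4 : 0 ≤ (4 * x)⁻¹ * (‖quadSum (b 0) N (z.1 - z.2)‖ - 2 * x) ^ 2 := by positivity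
              have h5 : (4 * x)⁻¹ * (‖quadSum (b 0) N (z.1 - z.2)‖ - 2 * x) ^ 2
                = x + (4 * x)⁻¹ * ‖quadSum (b 0) N (z.1 - z.2)‖ ^ 2
                  - ‖quadSum (b 0) N (z.1 - z.2)‖ := by
                field_simp
                ring
              simp only
              linarith
        _ = x * m ^ 2 + (4 * x)⁻¹ * ∫ z, ‖quadSum (b 0) N (z.1 - z.2)‖ ^ 2 ∂(ν.prod ν) := by
            rw [integral_add (integrable_const _)
              ((integrable_norm_quadSum_pow ν (b 0) N hN 2).const_mul _), integral_const_mul,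
              integral_const, ← Set.univ_prod_univ, measureReal_prod_prod]
            simp only [hν, measureReal_restrict_apply_univ, smul_eq_mul]
            ring
        _ ≤ _ := by
            gcongr
            exact hW 0
    have h6 : x * m ^ 2 ≤ (4 * x)⁻¹ * W := by
      have : δ ^ 2 * N * m ^ 2 = 2 * (x * m ^ 2) := by rw [hx]; ring
      linarith
    rw [← div_eq_inv_mul, le_div_iff₀ (by positivity)] at h6
    have h7 : x * m ^ 2 * (4 * x) = δ ^ 4 * (N ^ 2 * m ^ 2) := by rw [hx]; ring
    have h8 : 0 ≤ δ ^ 4 * (N ^ 2 * m ^ 2) := by positivity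
    calc δ ^ 4 / 2 * (N ^ 2 * m ^ 2) = δ ^ 4 * (N ^ 2 * m ^ 2) / 2 := by ring
      _ ≤ W := by linarith
  · obtain ⟨s, rfl⟩ : ∃ s, r = s + 2 := ⟨r - 2, by omega⟩
    have hc : critExp (s + 2) = 2 := by simp [critExp]
    rw [hc]
    have hpt : ∀ z : ℝ × ℝ, ‖∏ i, quadSum (b i) N (z.1 - z.2)‖ ≤ (2 * N) ^ s / 2 *
        (‖quadSum (b 0) N (z.1 - z.2)‖ ^ 2 + ‖quadSum (b 1) N (z.1 - z.2)‖ ^ 2) := by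
      intro z
      rw [norm_prod, Fin.prod_univ_succ, Fin.prod_univ_succ]
      have h2 : ∏ i : Fin s, ‖quadSum (b i.succ.succ) N (z.1 - z.2)‖ ≤ (2 * N) ^ s := by
        refine (Finset.prod_le_prod (fun _ _ => norm_nonneg _)
          fun i _ => norm_quadSum_le (b i.succ.succ) N _ hN).trans ?_
        simp
      rw [Fin.succ_zero_eq_one]
      set u := ‖quadSum (b 0) N (z.1 - z.2)‖
      set v := ‖quadSum (b 1) N (z.1 - z.2)‖
      calc u * (v * ∏ i : Fin s, ‖quadSum (b i.succ.succ) N (z.1 - z.2)‖)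
          ≤ u * (v * (2 * N) ^ s) := by gcongr
        _ = (2 * N) ^ s / 2 * (2 * (u * v)) := by ring
        _ ≤ _ := by
            gcongr
            nlinarith [sq_nonneg (u - v)]
    have hI := fun i => integrable_norm_quadSum_pow ν (b i) N hN 2
    have h3 : V ≤ (2 * N) ^ s / 2 * (W + W) := by
      calc V ≤ ∫ z, (2 * N) ^ s / 2 *
            (‖quadSum (b 0) N (z.1 - z.2)‖ ^ 2 + ‖quadSum (b 1) N (z.1 - z.2)‖ ^ 2) ∂(ν.prod ν) :=
            integral_mono_of_nonneg (ae_of_all _ fun z => norm_nonneg _)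
              (((hI 0).add (hI 1)).const_mul _) (ae_of_all _ hpt)
        _ = (2 * N) ^ s / 2 * (∫ z, ‖quadSum (b 0) N (z.1 - z.2)‖ ^ 2 ∂(ν.prod ν)
            + ∫ z, ‖quadSum (b 1) N (z.1 - z.2)‖ ^ 2 ∂(ν.prod ν)) := by
            rw [integral_const_mul, integral_add (hI 0) (hI 1)]
        _ ≤ _ := by
            gcongr
            · exact hW 0
            · exact hW 1
    have h4 : δ ^ 2 * (N ^ 2 * m ^ 2) * N ^ s ≤ 2 ^ s * W * N ^ s := by
      calc _ = δ ^ 2 * N ^ (s + 2) * m ^ 2 := by ring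
        _ ≤ _ := h1.trans h3
        _ = _ := by rw [mul_pow]; ring
    have h5 := le_of_mul_le_mul_right h4 (by positivity)
    rw [div_mul_eq_mul_div, div_le_iff₀ (by positivity)]
    refine h5.trans ?_
    rw [mul_comm]
    gcongr
    · exact one_le_two
    · omega

lemma abs_sub_le_of_mem_Icc_ceil_floor {b N : ℝ} {m n : ℤ} (hm : m ∈ Finset.Icc ⌈b⌉ ⌊b + N⌋)
    (hn : n ∈ Finset.Icc ⌈b⌉ ⌊b + N⌋) : |((m - n : ℤ) : ℝ)| ≤ N := by
  rw [Finset.mem_Icc, Int.ceil_le, Int.le_floor] at hm hn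
  push_cast
  rw [abs_le]
  constructor <;> linarith [hm.1, hm.2, hn.1, hn.2]

lemma card_filter_boxFreq_le (s : ℕ) (ε : ℝ) (hε : 0 < ε) :
    ∃ C : ℝ, 0 < C ∧ ∀ (b : Fin (s + 2) → ℝ) (N : ℝ), 1 < N → ∀ k : ℤ,
      (((latticeBox (s + 2) b N).filter fun ξ => boxFreq ξ = k).card : ℝ) ≤ C * N ^ ε * N ^ s := by
  obtain ⟨C, hC, hcirc⟩ := card_circle_inter_box_le ε hε
  refine ⟨C * 2 ^ s, by positivity, fun b N hN k => ?_⟩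
  set S := (latticeBox (s + 2) b N).filter fun ξ => boxFreq ξ = k with hS
  set T : Finset (Fin s → ℤ) :=
    Fintype.piFinset fun i => Finset.Icc ⌈b i.succ.succ⌉ ⌊b i.succ.succ + N⌋ with hT
  have hmem : ∀ ξ ∈ S, ∀ i, ξ i ∈ Finset.Icc ⌈b i⌉ ⌊b i + N⌋ := fun ξ hξ => by
    rw [hS, Finset.mem_filter, latticeBox, Fintype.mem_piFinset] at hξ
    exact hξ.1
  have hfreq : ∀ ξ ∈ S, ξ 0 ^ 2 + ξ 1 ^ 2 = -k - ∑ i : Fin s, ξ i.succ.succ ^ 2 := fun ξ hξ => by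
    rw [hS, Finset.mem_filter, boxFreq, Fin.sum_univ_succ, Fin.sum_univ_succ,
      Fin.succ_zero_eq_one] at hξ
    linarith [hξ.2]
  have hmaps : ∀ ξ ∈ S, (fun i : Fin s => ξ i.succ.succ) ∈ T := fun ξ hξ => by
    rw [hT, Fintype.mem_piFinset]
    exact fun i => hmem ξ hξ _
  have hTcard : (T.card : ℝ) ≤ (2 * N) ^ s := by
    rw [hT, Fintype.card_piFinset]
    push_cast
    refine (Finset.prod_le_prod (fun _ _ => by positivity)
      fun i _ => card_Icc_ceil_floor_le (b i.succ.succ) N hN).trans ?_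
    simp
  have hfib : ∀ τ ∈ T, ((S.filter fun ξ => (fun i : Fin s => ξ i.succ.succ) = τ).card : ℝ)
      ≤ C * N ^ ε := by
    intro τ _
    set R := S.filter fun ξ => (fun i : Fin s => ξ i.succ.succ) = τ with hR
    have hinj : Set.InjOn (fun ξ : Fin (s + 2) → ℤ => (ξ 0, ξ 1)) R := by
      intro ξ hξ η hη h
      rw [Finset.mem_coe, hR, Finset.mem_filter] at hξ hη
      simp only [Prod.mk.injEq] at h
      funext i
      refine Fin.cases h.1 (fun i => ?_) i
      refine Fin.cases h.2 (fun i => ?_) i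
      exact congrFun (hξ.2.trans hη.2.symm) i
    rw [← Finset.card_image_of_injOn hinj]
    refine hcirc N hN (-k - ∑ i : Fin s, τ i ^ 2) _ ?_ ?_
    · intro z hz
      obtain ⟨ξ, hξ, rfl⟩ := Finset.mem_image.1 hz
      rw [hR, Finset.mem_filter] at hξ
      rw [← hξ.2]
      exact hfreq ξ hξ.1
    · intro z hz w hw
      obtain ⟨ξ, hξ, rfl⟩ := Finset.mem_image.1 hz
      obtain ⟨η, hη, rfl⟩ := Finset.mem_image.1 hw
      rw [hR, Finset.mem_filter] at hξ hη
      exact ⟨abs_sub_le_of_mem_Icc_ceil_floor (hmem ξ hξ.1 0) (hmem η hη.1 0),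
        abs_sub_le_of_mem_Icc_ceil_floor (hmem ξ hξ.1 1) (hmem η hη.1 1)⟩
  rw [Finset.card_eq_sum_card_fiberwise hmaps]
  push_cast
  calc _ ≤ T.card • (C * N ^ ε) := Finset.sum_le_card_nsmul _ _ _ hfib
    _ = T.card * (C * N ^ ε) := nsmul_eq_mul _ _
    _ ≤ (2 * N) ^ s * (C * N ^ ε) := by gcongr
    _ = _ := by rw [mul_pow]; ring

lemma card_filter_boxFreq_add_le (ε : ℝ) (hε : 0 < ε) :
    ∃ C : ℝ, 0 < C ∧ ∀ (b : Fin 1 → ℝ) (N : ℝ), 1 < N → ∀ k : ℤ,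
      (((latticeBox 1 b N ×ˢ latticeBox 1 b N).filter
        fun z => boxFreq z.1 + boxFreq z.2 = k).card : ℝ) ≤ C * N ^ ε := by
  obtain ⟨C, hC, hcirc⟩ := card_circle_inter_box_le ε hε
  refine ⟨C, hC, fun b N hN k => ?_⟩
  set S := (latticeBox 1 b N ×ˢ latticeBox 1 b N).filter
    fun z => boxFreq z.1 + boxFreq z.2 = k with hS
  have hinj : Set.InjOn (fun z : (Fin 1 → ℤ) × (Fin 1 → ℤ) => (z.1 0, z.2 0)) S := by
    rintro ⟨ξ, η⟩ _ ⟨ξ', η'⟩ _ h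
    simp only [Prod.mk.injEq] at h ⊢
    constructor <;> funext i <;> rw [Subsingleton.elim i 0]
    exacts [h.1, h.2]
  have hmem : ∀ z ∈ S, z.1 0 ∈ Finset.Icc ⌈b 0⌉ ⌊b 0 + N⌋ ∧ z.2 0 ∈ Finset.Icc ⌈b 0⌉ ⌊b 0 + N⌋ := by
    intro z hz
    rw [hS, Finset.mem_filter, Finset.mem_product, latticeBox, Fintype.mem_piFinset,
      Fintype.mem_piFinset] at hz
    exact ⟨hz.1.1 0, hz.1.2 0⟩
  rw [← Finset.card_image_of_injOn hinj]
  refine hcirc N hN (-k) _ ?_ ?_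
  · intro z hz
    obtain ⟨⟨ξ, η⟩, hξ, rfl⟩ := Finset.mem_image.1 hz
    rw [hS, Finset.mem_filter] at hξ
    have := hξ.2
    simp only [boxFreq, Fin.sum_univ_one] at this ⊢
    omega
  · intro z hz w hw
    obtain ⟨x, hx, rfl⟩ := Finset.mem_image.1 hz
    obtain ⟨y, hy, rfl⟩ := Finset.mem_image.1 hw
    exact ⟨abs_sub_le_of_mem_Icc_ceil_floor (hmem x hx).1 (hmem y hy).1,
        abs_sub_le_of_mem_Icc_ceil_floor (hmem x hx).2 (hmem y hy).2⟩

lemma mul_measureReal_le_integral (E : Set ℝ) (hE : E ⊆ Set.Ioc 0 (2 * π)) (hEm : MeasurableSet E)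
    (f : ℝ → ℝ) (hf : Continuous f) (hf0 : ∀ t, 0 ≤ f t) (l : ℝ) (hl : ∀ t ∈ E, l ≤ f t) :
    l * volume.real E ≤ ∫ t in (0 : ℝ)..(2 * π), f t := by
  have hfin : volume E ≠ ⊤ := measure_ne_top_of_subset hE measure_Ioc_lt_top.ne
  have hInt : IntegrableOn f (Set.Ioc 0 (2 * π)) :=
    hf.integrableOn_Icc.mono_set Set.Ioc_subset_Icc_self
  rw [intervalIntegral.integral_of_le two_pi_pos.le]
  calc l * volume.real E = ∫ t in E, l := by rw [setIntegral_const, smul_eq_mul, mul_comm]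
    _ ≤ ∫ t in E, f t := setIntegral_mono_on
        (integrable_const_iff.2 (Or.inr ⟨by simpa using hfin.lt_top⟩)) (hInt.mono_set hE) hEm hl
    _ ≤ _ := setIntegral_mono_set hInt (ae_of_all _ hf0) (ae_of_all _ hE)

lemma pow_critExp_mul_le_rpow (r : ℕ) (hr : 1 ≤ r) (ε : ℝ) (hε : 0 < ε) :
    ∃ C : ℝ, 0 < C ∧ ∀ (b : Fin r → ℝ) (N : ℝ), 1 < N → ∀ (a : (Fin r → ℤ) → ℂ),
      0 < ∑ ξ ∈ latticeBox r b N, ‖a ξ‖ ^ 2 → ∀ δ : ℝ, 0 < δ → ∀ E : Set ℝ,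
      E ⊆ Set.Ioc 0 (2 * π) → MeasurableSet E →
      (∀ t ∈ E, δ ^ 2 * N ^ r * ∑ ξ ∈ latticeBox r b N, ‖a ξ‖ ^ 2
        ≤ ‖∑ ξ ∈ latticeBox r b N, a ξ * expChar (boxFreq ξ) t‖ ^ 2) →
      δ ^ critExp r * (N ^ 2 * volume.real E) ≤ C * N ^ ε := by
  rcases hr.eq_or_lt with rfl | hr2
  · obtain ⟨C, hC, hcard⟩ := card_filter_boxFreq_add_le ε hε
    refine ⟨2 * π * C, by positivity, fun b N hN a ha δ hδ E hE hEm hF => ?_⟩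
    set A2 := ∑ ξ ∈ latticeBox 1 b N, ‖a ξ‖ ^ 2 with hA2
    have h1 := mul_measureReal_le_integral E hE hEm
      (fun t => ‖∑ z ∈ latticeBox 1 b N ×ˢ latticeBox 1 b N,
        (a z.1 * a z.2) * expChar (boxFreq z.1 + boxFreq z.2) t‖ ^ 2)
      ((continuous_finsetSum _ fun i _ =>
        continuous_const.mul (continuous_expChar _)).norm.pow 2) (fun t => by positivity)
      ((δ ^ 2 * N ^ 1 * A2) ^ 2) fun t ht => by
        have h2 : ∑ z ∈ latticeBox 1 b N ×ˢ latticeBox 1 b N,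
          (a z.1 * a z.2) * expChar (boxFreq z.1 + boxFreq z.2) t
          = (∑ ξ ∈ latticeBox 1 b N, a ξ * expChar (boxFreq ξ) t) ^ 2 := by
          rw [sq, Finset.sum_mul_sum, ← Finset.sum_product']
          refine Finset.sum_congr rfl fun z _ => ?_
          rw [expChar_add]
          ring
        rw [h2, norm_pow]
        exact pow_le_pow_left₀ (by positivity) (hF t ht) 2
    have h3 := integral_norm_sum_expChar_sq_le (latticeBox 1 b N ×ˢ latticeBox 1 b N)
      (fun z => boxFreq z.1 + boxFreq z.2) (fun z => a z.1 * a z.2) _ (hcard b N hN)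
    have h4 : ∑ z ∈ latticeBox 1 b N ×ˢ latticeBox 1 b N, ‖a z.1 * a z.2‖ ^ 2 = A2 ^ 2 := by
      rw [sq A2, hA2, Finset.sum_mul_sum, ← Finset.sum_product']
      refine Finset.sum_congr rfl fun z _ => ?_
      rw [norm_mul, mul_pow]
    rw [h4] at h3
    have hc : critExp 1 = 4 := rfl
    rw [hc]
    refine le_of_mul_le_mul_right ?_ (pow_pos ha 2)
    calc _ = (δ ^ 2 * N ^ 1 * A2) ^ 2 * volume.real E := by ring
      _ ≤ _ := h1.trans h3
      _ = _ := by ring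
  · obtain ⟨s, rfl⟩ : ∃ s, r = s + 2 := ⟨r - 2, by omega⟩
    have hc : critExp (s + 2) = 2 := by simp [critExp]
    rw [hc]
    obtain ⟨C, hC, hcard⟩ := card_filter_boxFreq_le s ε hε
    refine ⟨2 * π * C, by positivity, fun b N hN a ha δ hδ E hE hEm hF => ?_⟩
    have h1 := mul_measureReal_le_integral E hE hEm _
      ((continuous_finsetSum _ fun i _ =>
        continuous_const.mul (continuous_expChar _)).norm.pow 2) (fun t => sq_nonneg _) _ hF
    have h3 := integral_norm_sum_expChar_sq_le (latticeBox (s + 2) b N) boxFreq a _ (hcard b N hN)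
    have hNs : 0 < N ^ s := pow_pos (by linarith) s
    refine le_of_mul_le_mul_right ?_ (mul_pos ha hNs)
    calc _ = (δ ^ 2 * N ^ (s + 2) * ∑ ξ ∈ latticeBox (s + 2) b N, ‖a ξ‖ ^ 2) * volume.real E := by
          ring
      _ ≤ _ := h1.trans h3
      _ = _ := by ring

lemma sq_mul_measureReal_le (r : ℕ) (hr : 1 ≤ r) (ε : ℝ) (hε : 0 < ε) :
    ∃ C : ℝ, 0 < C ∧ ∀ (b : Fin r → ℝ) (N : ℝ), 1 < N → ∀ (a : (Fin r → ℤ) → ℂ),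
      0 < ∑ ξ ∈ latticeBox r b N, ‖a ξ‖ ^ 2 → ∀ δ : ℝ, 0 < δ → δ ≤ 2 ^ r → ∀ E : Set ℝ,
      E ⊆ Set.Ioc 0 (2 * π) → MeasurableSet E →
      (∀ t ∈ E, δ ^ 2 * N ^ r * ∑ ξ ∈ latticeBox r b N, ‖a ξ‖ ^ 2
        ≤ ‖∑ ξ ∈ latticeBox r b N, a ξ * expChar (boxFreq ξ) t‖ ^ 2) →
      N ^ 2 * volume.real E ≤ C * ((δ ^ critExp r)⁻¹) ^ (1 + ε) := by
  obtain ⟨C₁, hC₁, h₁⟩ := integral_prod_norm_quadSum_sq_le ε hε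
  obtain ⟨C₂, hC₂, h₂⟩ := pow_critExp_mul_le_rpow r hr (ε / 2) (by positivity)
  set P := critExp r with hP
  set C₃ : ℝ := (2 ^ r) ^ P + 2 * C₁ * 2 ^ r with hC₃
  have hC₃0 : 0 < C₃ := by positivity
  refine ⟨C₃ * (2 * C₃) ^ ε + C₂ * (192 * C₃ ^ 2) ^ (ε / 2), by positivity, ?_⟩
  intro b N hN a ha δ hδ hδr E hE hEm hF
  have hN0 : 0 < N := by linarith
  set m := volume.real E with hm
  have hm0 : 0 ≤ m := measureReal_nonneg
  set y := (δ ^ P)⁻¹ with hy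
  have hy0 : 0 < y := by positivity
  have hδP : 0 < δ ^ P := by positivity
  have hyδ : δ ^ P = y⁻¹ := by rw [hy, inv_inv]
  set x := max 1 (2 * C₁ * 2 ^ r * y) with hx
  have hx1 : 1 ≤ x := le_max_left _ _
  have hxy : x ≤ C₃ * y := by
    refine max_le ?_ ?_
    · calc (1 : ℝ) = δ ^ P * y := by rw [hy, mul_inv_cancel₀ hδP.ne']
        _ ≤ (2 ^ r) ^ P * y := by gcongr
        _ ≤ C₃ * y := by
            gcongr
            rw [hC₃]
            linarith [show 0 < 2 * C₁ * 2 ^ r by positivity]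
    · gcongr
      rw [hC₃]
      linarith [show (0 : ℝ) < (2 ^ r) ^ P by positivity]
  obtain ⟨k, hk1, hk2⟩ := exists_nat_pow_near hx1 one_lt_two
  set n := k + 1 with hn
  have hn2 : (2 : ℝ) ^ n ≤ 2 * x := by rw [hn, pow_succ]; linarith
  have hypow : y * y ^ ε = y ^ (1 + ε) := by rw [Real.rpow_add hy0, Real.rpow_one]
  rcases le_or_gt (12 * ((n : ℝ) + 3) * 2 ^ n) N with hNn | hNn
  · have h3 := pow_critExp_mul_le r hr b N hN a ha δ hδ E hE hEm hF _
      fun i => h₁ (b i) N n E hN hNn hE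
    rcases hm0.eq_or_lt with h0 | h0
    · rw [← h0, mul_zero]; positivity
    have h4 : C₁ * (N ^ 2 / 2 ^ n * m ^ 2) ≤ y⁻¹ / 2 ^ r / 2 * (N ^ 2 * m ^ 2) := by
      have h5 : 2 * C₁ * 2 ^ r * y ≤ 2 ^ n := (le_max_right _ _).trans hk2.le
      have h6 : C₁ / 2 ^ n ≤ y⁻¹ / 2 ^ r / 2 := by
        rw [div_div, div_le_div_iff₀ (by positivity) (by positivity)]
        calc C₁ * (2 ^ r * 2) = y⁻¹ * (2 * C₁ * 2 ^ r * y) := by field_simp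
          _ ≤ _ := by gcongr
      calc C₁ * (N ^ 2 / 2 ^ n * m ^ 2) = C₁ / 2 ^ n * (N ^ 2 * m ^ 2) := by ring
        _ ≤ _ := by gcongr
    rw [hyδ, ← hm, mul_add] at h3
    have h7 : y⁻¹ / 2 ^ r / 2 * (N ^ 2 * m) * m ≤ C₁ * 2 ^ (ε * n) * m := by
      have e1 : y⁻¹ / 2 ^ r * (N ^ 2 * m ^ 2) = 2 * (y⁻¹ / 2 ^ r / 2 * (N ^ 2 * m ^ 2)) := by ring
      have e2 : y⁻¹ / 2 ^ r / 2 * (N ^ 2 * m) * m = y⁻¹ / 2 ^ r / 2 * (N ^ 2 * m ^ 2) := by ring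
      linarith
    have h8 := le_of_mul_le_mul_right h7 h0
    have h9 : (2 : ℝ) ^ (ε * n) ≤ (2 * C₃) ^ ε * y ^ ε := by
      rw [mul_comm, Real.rpow_mul two_pos.le, Real.rpow_natCast,
        ← Real.mul_rpow (by positivity) hy0.le]
      gcongr
      linarith
    have h10 : N ^ 2 * m ≤ 2 * C₁ * 2 ^ r * y * 2 ^ (ε * n) := by
      calc N ^ 2 * m = 2 * 2 ^ r * y * (y⁻¹ / 2 ^ r / 2 * (N ^ 2 * m)) := by field_simp
        _ ≤ 2 * 2 ^ r * y * (C₁ * 2 ^ (ε * n)) := by gcongr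
        _ = _ := by ring
    calc N ^ 2 * m ≤ 2 * C₁ * 2 ^ r * y * 2 ^ (ε * n) := h10
      _ ≤ C₃ * y * ((2 * C₃) ^ ε * y ^ ε) := by
          gcongr ?_ * ?_
          exact (le_max_right _ _).trans hxy
      _ = C₃ * (2 * C₃) ^ ε * (y * y ^ ε) := by ring
      _ ≤ _ := by
          rw [hypow]
          gcongr
          linarith [show 0 < C₂ * (192 * C₃ ^ 2) ^ (ε / 2) by positivity]
  · have h3 := h₂ b N hN a ha δ hδ E hE hEm hF
    rw [hyδ, ← hm] at h3
    have hN192 : N ≤ 192 * C₃ ^ 2 * y ^ 2 := by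
      have h4 : (n : ℝ) + 3 ≤ 4 * 2 ^ n := by
        have h5 : (n : ℝ) ≤ 2 ^ n := by exact_mod_cast Nat.lt_two_pow_self.le
        have h6 : (1 : ℝ) ≤ 2 ^ n := one_le_pow₀ one_le_two
        linarith
      calc N ≤ 12 * ((n : ℝ) + 3) * 2 ^ n := hNn.le
        _ ≤ 12 * (4 * 2 ^ n) * 2 ^ n := by gcongr
        _ = 48 * (2 ^ n) ^ 2 := by ring
        _ ≤ 48 * (2 * (C₃ * y)) ^ 2 := by gcongr; linarith
        _ = _ := by ring
    have h5 : N ^ (ε / 2) ≤ (192 * C₃ ^ 2) ^ (ε / 2) * y ^ ε := by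
      calc N ^ (ε / 2) ≤ (192 * C₃ ^ 2 * y ^ 2) ^ (ε / 2) := by gcongr
        _ = _ := by
            rw [Real.mul_rpow (by positivity) (by positivity), ← Real.rpow_natCast y 2,
              ← Real.rpow_mul hy0.le]
            congr 2
            push_cast
            ring
    calc N ^ 2 * m = y * (y⁻¹ * (N ^ 2 * m)) := by field_simp
      _ ≤ y * (C₂ * ((192 * C₃ ^ 2) ^ (ε / 2) * y ^ ε)) := by
          exact mul_le_mul_of_nonneg_left
            (h3.trans (mul_le_mul_of_nonneg_left h5 hC₂.le)) hy0.le
      _ = C₂ * (192 * C₃ ^ 2) ^ (ε / 2) * (y * y ^ ε) := by ring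
      _ ≤ _ := by
          rw [hypow]
          gcongr
          linarith [show 0 < C₃ * (2 * C₃) ^ ε by positivity]

lemma norm_sum_sq_le (r : ℕ) (b : Fin r → ℝ) (N : ℝ) (hN : 1 < N) (a : (Fin r → ℤ) → ℂ) (t : ℝ) :
    ‖∑ ξ ∈ latticeBox r b N, a ξ * expChar (boxFreq ξ) t‖ ^ 2
      ≤ (2 * N) ^ r * ∑ ξ ∈ latticeBox r b N, ‖a ξ‖ ^ 2 := by
  have h1 : ‖∑ ξ ∈ latticeBox r b N, a ξ * expChar (boxFreq ξ) t‖
      ≤ ∑ ξ ∈ latticeBox r b N, 1 * ‖a ξ‖ :=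
    norm_sum_le_of_le _ fun ξ _ => by rw [norm_mul, norm_expChar, mul_one, one_mul]
  have h2 : ((latticeBox r b N).card : ℝ) ≤ (2 * N) ^ r := by
    rw [latticeBox, Fintype.card_piFinset]
    push_cast
    refine (Finset.prod_le_prod (fun _ _ => by positivity)
      fun i _ => card_Icc_ceil_floor_le (b i) N hN).trans ?_
    simp
  calc _ ≤ (∑ ξ ∈ latticeBox r b N, 1 * ‖a ξ‖) ^ 2 := by gcongr
    _ ≤ (∑ ξ ∈ latticeBox r b N, (1 : ℝ) ^ 2) * ∑ ξ ∈ latticeBox r b N, ‖a ξ‖ ^ 2 :=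
        Finset.sum_mul_sq_le_sq_mul_sq _ _ _
    _ ≤ _ := by
        gcongr
        simpa using h2

/-- Strong-type bounds below the weak-type exponent for a bounded function on a finite interval. -/
lemma integral_rpow_le_of_measureReal_le (p q R K : ℝ) (hp : 0 < p) (hqp : q < p) (hR : 0 < R)
    (hK : 0 ≤ K) (f : ℝ → ℝ) (hf : Continuous f) (hf0 : ∀ t, 0 ≤ f t) (hfR : ∀ t, f t ≤ R)
    (hweak : ∀ δ, 0 < δ → δ ≤ R →
      volume.real {t ∈ Set.Ioc 0 (2 * π) | δ < f t} ≤ K * δ ^ (-q)) :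
    ∫ t in (0 : ℝ)..(2 * π), f t ^ p ≤ K * (p * (R ^ (p - q) / (p - q))) := by
  have hpq : 0 < p - q := sub_pos.2 hqp
  set ν := volume.restrict (Set.Ioc 0 (2 * π)) with hν
  have h1 := lintegral_rpow_eq_lintegral_meas_lt_mul ν (ae_of_all _ hf0) hf.aemeasurable hp
  have hcont : Continuous fun t => f t ^ p := hf.rpow_const fun t => Or.inr hp.le
  have h2 : ∫⁻ t in Set.Ioi 0, ν {a | t < f a} * ENNReal.ofReal (t ^ (p - 1))
      ≤ ENNReal.ofReal (K * (R ^ (p - q) / (p - q))) := by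
    have h3 : ∀ t ∈ Set.Ioi (0 : ℝ), ν {a | t < f a} * ENNReal.ofReal (t ^ (p - 1))
        ≤ (Set.Ioc 0 R).indicator (fun t => ENNReal.ofReal (K * t ^ (p - q - 1))) t := by
      intro t ht
      rw [Set.mem_Ioi] at ht
      have hmeas : MeasurableSet {a | t < f a} := measurableSet_lt measurable_const hf.measurable
      rcases le_or_gt t R with htR | htR
      · rw [Set.indicator_of_mem (show t ∈ Set.Ioc 0 R from ⟨ht, htR⟩)]
        have h4 : ν {a | t < f a} = ENNReal.ofReal
            (volume.real {s ∈ Set.Ioc 0 (2 * π) | t < f s}) := by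
          rw [hν, Measure.restrict_apply hmeas, ofReal_measureReal
            (measure_ne_top_of_subset (Set.sep_subset _ _) measure_Ioc_lt_top.ne)]
          congr 1
          ext s
          simp [and_comm]
        rw [h4, ← ENNReal.ofReal_mul measureReal_nonneg]
        apply ENNReal.ofReal_le_ofReal
        calc _ ≤ K * t ^ (-q) * t ^ (p - 1) := by
              gcongr
              exact hweak t ht htR
          _ = K * t ^ (p - q - 1) := by
              rw [mul_assoc, ← Real.rpow_add ht]
              ring_nf
      · have h4 : {a | t < f a} = ∅ := by
          ext s
          simp only [Set.mem_ofPred_eq, Set.mem_empty_iff_false, iff_false, not_lt]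
          exact (hfR s).trans htR.le
        rw [h4]
        simp
    have hii : IntervalIntegrable (fun t : ℝ => K * t ^ (p - q - 1)) volume 0 R :=
      (intervalIntegral.intervalIntegrable_rpow' (by linarith)).const_mul K
    calc _ ≤ ∫⁻ t in Set.Ioi 0,
          (Set.Ioc 0 R).indicator (fun t => ENNReal.ofReal (K * t ^ (p - q - 1))) t :=
          setLIntegral_mono' measurableSet_Ioi h3
      _ ≤ ∫⁻ t, (Set.Ioc 0 R).indicator (fun t => ENNReal.ofReal (K * t ^ (p - q - 1))) t :=
          setLIntegral_le_lintegral _ _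
      _ = ∫⁻ t in Set.Ioc 0 R, ENNReal.ofReal (K * t ^ (p - q - 1)) :=
          lintegral_indicator measurableSet_Ioc _
      _ = ENNReal.ofReal (∫ t in Set.Ioc 0 R, K * t ^ (p - q - 1)) := by
          rw [ofReal_integral_eq_lintegral_ofReal]
          · exact (intervalIntegrable_iff_integrableOn_Ioc_of_le hR.le).1 hii
          · refine (ae_restrict_iff' measurableSet_Ioc).2 (ae_of_all _ fun t ht => ?_)
            have := ht.1
            simp only [Pi.zero_apply]
            positivity
      _ = _ := by
          rw [← intervalIntegral.integral_of_le hR.le, intervalIntegral.integral_const_mul,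
            integral_rpow (Or.inl (by linarith)), sub_add_cancel, Real.zero_rpow hpq.ne', sub_zero]
  rw [intervalIntegral.integral_of_le two_pi_pos.le,
    integral_eq_lintegral_of_nonneg_ae (ae_of_all _ fun t => Real.rpow_nonneg (hf0 t) p)
      hcont.aestronglyMeasurable]
  refine ENNReal.toReal_le_of_le_ofReal (by positivity) ?_
  rw [← hν, h1]
  calc _ ≤ ENNReal.ofReal p * ENNReal.ofReal (K * (R ^ (p - q) / (p - q))) := by gcongr
    _ = _ := by
        rw [← ENNReal.ofReal_mul hp.le]
        congr 1
        ring

theorem exponential_sum_Lp_estimate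
    (r : ℕ) (hr : 1 ≤ r) (p : ℝ) (hp : max (4 / (r : ℝ)) 2 < p) :
    ∃ C : ℝ, 0 < C ∧ ∀ (b : Fin r → ℝ) (N : ℝ), 1 < N →
      ∀ a : (Fin r → ℤ) → ℂ,
        (∫ t in (0:ℝ)..(2 * π),
            ‖∑ ξ ∈ latticeBox r b N,
                a ξ * Complex.exp (-(Complex.I * (t : ℂ) * (eNormSq ξ : ℂ)))‖ ^ p) ^ (1 / p)
          ≤ C * N ^ ((r : ℝ) / 2 - 2 / p) *
            (∑ ξ ∈ latticeBox r b N, ‖a ξ‖ ^ 2) ^ ((1 : ℝ) / 2) := by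
  have hP0 : (0 : ℝ) < critExp r := by unfold critExp; split_ifs <;> norm_num
  have hPp : (critExp r : ℝ) < p := by
    unfold critExp
    split_ifs with h
    · subst h
      have := (le_max_left _ _).trans_lt hp
      norm_num at this ⊢
      exact this
    · have := (le_max_right _ _).trans_lt hp
      norm_num
      exact this
  have hp0 : 0 < p := hP0.trans hPp
  set P := critExp r with hP
  set ε := (p / P - 1) / 2 with hε
  have hε0 : 0 < ε := by
    have : 1 < p / P := (one_lt_div hP0).2 hPp
    rw [hε]
    linarith
  set q := P * (1 + ε) with hq
  have hqp : q < p := by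
    have : q = (P + p) / 2 := by rw [hq, hε]; field_simp; ring
    linarith
  obtain ⟨C, hC, hweak⟩ := sq_mul_measureReal_le r hr ε hε0
  set B := C * (p * ((2 ^ r) ^ (p - q) / (p - q))) with hB
  have hB0 : 0 < B := by
    have := sub_pos.2 hqp
    positivity
  refine ⟨B ^ (1 / p), by positivity, fun b N hN a => ?_⟩
  have hN0 : 0 < N := by linarith
  simp_rw [cexp_eq_expChar]
  set A2 := ∑ ξ ∈ latticeBox r b N, ‖a ξ‖ ^ 2 with hA2
  set F : ℝ → ℂ := fun t => ∑ ξ ∈ latticeBox r b N, a ξ * expChar (boxFreq ξ) t with hF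
  change (∫ t in (0 : ℝ)..(2 * π), ‖F t‖ ^ p) ^ (1 / p) ≤ _
  have hFc : Continuous F := continuous_finsetSum _ fun i _ =>
    continuous_const.mul (continuous_expChar _)
  have hFle : ∀ t, ‖F t‖ ^ 2 ≤ (2 * N) ^ r * A2 := norm_sum_sq_le r b N hN a
  have hA20 : 0 ≤ A2 := by positivity
  rcases hA20.eq_or_lt with h0 | h0
  · have hF0 : ∀ t, ‖F t‖ = 0 := fun t => by
      have := hFle t
      rw [← h0, mul_zero] at this
      exact pow_eq_zero_iff two_ne_zero |>.1 (le_antisymm this (by positivity))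
    simp only [hF0, Real.zero_rpow hp0.ne', intervalIntegral.integral_zero]
    rw [Real.zero_rpow (by positivity)]
    positivity
  set M := √(N ^ r * A2) with hM
  have hM2 : M ^ 2 = N ^ r * A2 := Real.sq_sqrt (by positivity)
  have hM0 : 0 < M := Real.sqrt_pos.2 (by positivity)
  have hfR : ∀ t, ‖F t‖ / M ≤ 2 ^ r := fun t => by
    rw [div_le_iff₀ hM0]
    refine le_of_sq_le_sq ?_ (by positivity)
    calc ‖F t‖ ^ 2 ≤ 2 ^ r * (N ^ r * A2) := by rw [← mul_assoc, ← mul_pow]; exact hFle t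
      _ ≤ (2 ^ r) ^ 2 * (N ^ r * A2) := by
          gcongr
          exact le_self_pow₀ (one_le_pow₀ one_le_two) two_ne_zero
      _ = _ := by rw [mul_pow, hM2]
  have hstrong := integral_rpow_le_of_measureReal_le p q (2 ^ r) (C / N ^ 2) hp0 hqp (by positivity)
    (by positivity) (fun t => ‖F t‖ / M) (hFc.norm.div_const _) (fun t => by positivity) hfR
    fun δ hδ hδr => by
      rw [div_mul_eq_mul_div, le_div_iff₀' (by positivity)]
      have hmeas : MeasurableSet {t ∈ Set.Ioc 0 (2 * π) | δ < ‖F t‖ / M} :=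
        measurableSet_Ioc.inter
          (measurableSet_lt measurable_const (hFc.norm.div_const _).measurable)
      refine (hweak b N hN a h0 δ hδ hδr _ (Set.sep_subset _ _) hmeas ?_).trans (le_of_eq ?_)
      · rintro t ⟨-, ht⟩
        rw [lt_div_iff₀ hM0] at ht
        calc δ ^ 2 * N ^ r * A2 = (δ * M) ^ 2 := by rw [mul_pow, hM2]; ring
          _ ≤ ‖F t‖ ^ 2 := by gcongr
      · rw [← hP, ← Real.rpow_natCast, ← Real.rpow_neg hδ.le, ← Real.rpow_mul hδ.le, hq]
        ring_nf
  have hscale : ∫ t in (0 : ℝ)..(2 * π), ‖F t‖ ^ p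
      = M ^ p * ∫ t in (0 : ℝ)..(2 * π), (‖F t‖ / M) ^ p := by
    rw [← intervalIntegral.integral_const_mul]
    congr 1
    ext t
    rw [← Real.mul_rpow hM0.le (by positivity), mul_div_cancel₀ _ hM0.ne']
  have hfinal : ∫ t in (0 : ℝ)..(2 * π), ‖F t‖ ^ p ≤ M ^ p * (B / N ^ 2) := by
    rw [hscale]
    gcongr
    refine hstrong.trans (le_of_eq ?_)
    rw [hB]
    ring
  have hI0 : 0 ≤ ∫ t in (0 : ℝ)..(2 * π), ‖F t‖ ^ p :=
    intervalIntegral.integral_nonneg two_pi_pos.le fun t _ => by positivity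
  calc _ ≤ (M ^ p * (B / N ^ 2)) ^ (1 / p) := by gcongr
    _ = M * (B ^ (1 / p) / N ^ (2 / p)) := by
        rw [Real.mul_rpow (by positivity) (by positivity), ← Real.rpow_mul hM0.le,
          mul_one_div_cancel hp0.ne', Real.rpow_one, Real.div_rpow hB0.le (by positivity),
          ← Real.rpow_natCast N 2, ← Real.rpow_mul hN0.le]
        congr 3
        push_cast
        ring
    _ = _ := by
        rw [hM, Real.sqrt_eq_rpow, Real.mul_rpow (by positivity) hA20, ← Real.rpow_natCast N r,
          ← Real.rpow_mul hN0.le, Real.rpow_sub hN0, mul_one_div]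
        ring
end
end

section
/- For every ε > 0 there exists a constant C = C(ε) > 0 such that for every real N ≥ 1, every b_1, b_2 ∈ ℝ, and every A ∈ ℝ, the number of pairs (n_1, n_2) ∈ ℤ² satisfying b_1 ≤ n_1 ≤ b_1 + N, b_2 ≤ n_2 ≤ b_2 + N, and n_1² + n_2² = A is at most C · N^ε. -/
/-- Up to associates, `x` has at most `m` divisors. -/
def HasAtMostDivisors {R : Type*} [CommMonoidWithZero R] (x : R) (m : ℕ) : Prop :=
  ∃ S : Finset R, S.card ≤ m ∧ ∀ z, z ∣ x → ∃ s ∈ S, Associated z s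

namespace HasAtMostDivisors

variable {R : Type*} [CommMonoidWithZero R]

theorem mul [DecompositionMonoid R] {x y : R} {m n : ℕ}
    (hx : HasAtMostDivisors x m) (hy : HasAtMostDivisors y n) :
    HasAtMostDivisors (x * y) (m * n) := by
  classical
  obtain ⟨S, hS, hSx⟩ := hx
  obtain ⟨T, hT, hTy⟩ := hy
  refine ⟨Finset.image₂ (· * ·) S T,
    (Finset.card_image₂_le _ S T).trans (Nat.mul_le_mul hS hT), fun z hz => ?_⟩
  obtain ⟨a, b, ha, hb, rfl⟩ := exists_dvd_and_dvd_of_dvd_mul hz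
  obtain ⟨s, hs, has⟩ := hSx a ha
  obtain ⟨t, ht, hbt⟩ := hTy b hb
  exact ⟨s * t, Finset.mem_image₂_of_mem hs ht, has.mul_mul hbt⟩

theorem one : HasAtMostDivisors (1 : R) 1 :=
  ⟨{1}, by simp, fun z hz => ⟨1, by simp, associated_one_iff_isUnit.2 (isUnit_of_dvd_one hz)⟩⟩

theorem prime_pow [IsCancelMulZero R] {p : R} (hp : Prime p) (k : ℕ) :
    HasAtMostDivisors (p ^ k) (k + 1) := by
  classical
  refine ⟨(Finset.range (k + 1)).image (p ^ ·),
    Finset.card_image_le.trans (by simp), fun z hz => ?_⟩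
  obtain ⟨i, hi, hzi⟩ := (dvd_prime_pow hp k).1 hz
  exact ⟨p ^ i, Finset.mem_image_of_mem _ (Finset.mem_range.2 (by omega)), hzi⟩

theorem mono {x : R} {m n : ℕ} (hx : HasAtMostDivisors x m) (hmn : m ≤ n) :
    HasAtMostDivisors x n := by
  obtain ⟨S, hS, h⟩ := hx
  exact ⟨S, hS.trans hmn, h⟩

end HasAtMostDivisors

theorem GaussianInt.prime_of_norm_eq_prime {z : GaussianInt} {p : ℕ} (hp : p.Prime)
    (hz : z.norm = p) : Prime z := by
  rw [← irreducible_iff_prime]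
  refine ⟨fun hu => ?_, fun a b hab => ?_⟩
  · have := Zsqrtd.norm_eq_one_iff.2 hu
    rw [hz] at this
    exact hp.one_lt.ne' (by simpa using this)
  · rw [← Zsqrtd.norm_eq_one_iff, ← Zsqrtd.norm_eq_one_iff]
    have h : a.norm.natAbs * b.norm.natAbs = p := by
      rw [← Int.natAbs_mul, ← Zsqrtd.norm_mul, ← hab, hz, Int.natAbs_natCast]
    rcases (Nat.prime_mul_iff.1 (h ▸ hp)) with h | h
    · exact Or.inr h.2
    · exact Or.inl h.2

theorem GaussianInt.hasAtMostDivisors_prime_pow {p : ℕ} (hp : p.Prime) (k : ℕ) :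
    HasAtMostDivisors ((p : GaussianInt) ^ k) ((k + 1) ^ 2) := by
  have := Fact.mk hp
  by_cases hpi : Irreducible (p : GaussianInt)
  · exact (HasAtMostDivisors.prime_pow hpi.prime k).mono (by nlinarith)
  · obtain ⟨a, b, hab⟩ := GaussianInt.sq_add_sq_of_nat_prime_of_not_irreducible p hpi
    have hab' : (a : ℤ) ^ 2 + (b : ℤ) ^ 2 = p := by exact_mod_cast hab
    have h1 : Prime (⟨a, b⟩ : GaussianInt) :=
      GaussianInt.prime_of_norm_eq_prime hp (by rw [Zsqrtd.norm_def, ← hab']; ring)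
    have h2 : Prime (⟨a, -b⟩ : GaussianInt) :=
      GaussianInt.prime_of_norm_eq_prime hp (by rw [Zsqrtd.norm_def, ← hab']; ring)
    have h : (p : GaussianInt) = ⟨a, b⟩ * ⟨a, -b⟩ := by
      ext
      · simp [← hab']; ring
      · simp; ring
    rw [h, mul_pow, sq]
    exact (HasAtMostDivisors.prime_pow h1 k).mul (HasAtMostDivisors.prime_pow h2 k)

theorem GaussianInt.hasAtMostDivisors_natCast (n : ℕ) (hn : n ≠ 0) :
    HasAtMostDivisors (n : GaussianInt) (n.divisors.card ^ 2) := by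
  induction n using Nat.recOnPosPrimePosCoprime with
  | prime_pow p k hp hk =>
    rw [Nat.divisors_prime_pow hp, Finset.card_map, Finset.card_range, Nat.cast_pow]
    exact GaussianInt.hasAtMostDivisors_prime_pow hp k
  | zero => exact absurd rfl hn
  | one => simpa using HasAtMostDivisors.one
  | coprime a b ha hb hab iha ihb =>
    rw [hab.card_divisors_mul, mul_pow, Nat.cast_mul]
    exact (iha (by omega)).mul (ihb (by omega))

theorem GaussianInt.isUnit_mem_Icc {u : GaussianInt} (hu : IsUnit u) :
    u.re ∈ Finset.Icc (-1) 1 ∧ u.im ∈ Finset.Icc (-1) 1 := by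
  have h := (Zsqrtd.norm_eq_one_iff' (by norm_num) u).2 hu
  rw [Zsqrtd.norm_def] at h
  simp only [Finset.mem_Icc]
  refine ⟨⟨?_, ?_⟩, ?_, ?_⟩ <;> nlinarith [mul_self_nonneg u.re, mul_self_nonneg u.im]

/-- A representation of `n` as a sum of two squares is a divisor of `n` in the Gaussian integers,
so there are at most `9 d(n)²` of them. -/
theorem ncard_sq_add_sq_le (n : ℕ) (hn : n ≠ 0) :
    {q : ℤ × ℤ | q.1 ^ 2 + q.2 ^ 2 = n}.Finite ∧
      {q : ℤ × ℤ | q.1 ^ 2 + q.2 ^ 2 = n}.ncard ≤ 9 * n.divisors.card ^ 2 := by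
  classical
  obtain ⟨S, hS, h⟩ := GaussianInt.hasAtMostDivisors_natCast n hn
  let U : Finset (ℤ × ℤ) := Finset.Icc (-1) 1 ×ˢ Finset.Icc (-1) 1
  let f : GaussianInt → ℤ × ℤ → ℤ × ℤ := fun s u =>
    ((s * ⟨u.1, u.2⟩ : GaussianInt).re, (s * ⟨u.1, u.2⟩ : GaussianInt).im)
  have hsub : {q : ℤ × ℤ | q.1 ^ 2 + q.2 ^ 2 = n} ⊆ (Finset.image₂ f S U : Finset (ℤ × ℤ)) := by
    rintro ⟨x, y⟩ hxy
    change x ^ 2 + y ^ 2 = (n : ℤ) at hxy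
    have hdvd : (⟨x, y⟩ : GaussianInt) ∣ n := by
      refine ⟨⟨x, -y⟩, ?_⟩
      ext
      · simp [← hxy]; ring
      · simp; ring
    obtain ⟨s, hs, hxs⟩ := h _ hdvd
    obtain ⟨u, hu⟩ := hxs.symm
    obtain ⟨h1, h2⟩ := GaussianInt.isUnit_mem_Icc u.isUnit
    refine Finset.mem_coe.2 (Finset.mem_image₂.2
      ⟨s, hs, ((u : GaussianInt).re, (u : GaussianInt).im), Finset.mem_product.2 ⟨h1, h2⟩, ?_⟩)
    change ((s * (u : GaussianInt)).re, (s * (u : GaussianInt)).im) = (x, y)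
    rw [hu]
  refine ⟨(Finset.finite_toSet _).subset hsub, ?_⟩
  refine (Set.ncard_le_ncard hsub (Finset.finite_toSet _)).trans ?_
  rw [Set.ncard_coe_finset]
  refine (Finset.card_image₂_le f S U).trans ?_
  have hU : U.card = 9 := by decide
  rw [hU, mul_comm]
  exact Nat.mul_le_mul_left 9 hS

theorem exists_add_one_le_mul_two_rpow (ε : ℝ) (hε : 0 < ε) :
    ∃ B : ℝ, 1 ≤ B ∧ ∀ k : ℕ, (k : ℝ) + 1 ≤ B * (2 : ℝ) ^ (ε * k) := by
  have hc : 0 < ε * Real.log 2 := mul_pos hε (Real.log_pos one_lt_two)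
  refine ⟨1 + 1 / (ε * Real.log 2), by linarith [one_div_pos.2 hc], fun k => ?_⟩
  rw [Real.rpow_def_of_pos two_pos]
  set c := ε * Real.log 2 with hcdef
  have h1 : Real.log 2 * (ε * k) = c * k := by rw [hcdef]; ring
  have h2 : c * k + 1 ≤ Real.exp (c * k) := Real.add_one_le_exp _
  have hk : (0 : ℝ) ≤ k := k.cast_nonneg
  rw [h1]
  calc (k : ℝ) + 1 ≤ (1 + 1 / c) * (c * k + 1) := by
        have : (1 + 1 / c) * (c * k + 1) = k + 1 + (c * k + 1 / c) := by field_simp; ring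
        have : 0 ≤ c * k + 1 / c := by positivity
        linarith
    _ ≤ _ := by gcongr

theorem exists_card_divisors_le_mul_rpow (ε : ℝ) (hε : 0 < ε) :
    ∃ C : ℝ, 1 ≤ C ∧ ∀ n : ℕ, n ≠ 0 → (n.divisors.card : ℝ) ≤ C * (n : ℝ) ^ ε := by
  obtain ⟨B, hB, hBk⟩ := exists_add_one_le_mul_two_rpow ε hε
  obtain ⟨M, hM⟩ := exists_nat_ge ((2 : ℝ) ^ (1 / ε))
  refine ⟨B ^ M, one_le_pow₀ hB, fun n hn => ?_⟩
  have hlocal : ∀ p ∈ n.primeFactors, ((n.factorization p + 1 : ℕ) : ℝ) ≤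
      (if p < M then B else 1) * ((p : ℝ) ^ (n.factorization p)) ^ ε := by
    intro p hp
    have hp2 : (2 : ℝ) ≤ p := by exact_mod_cast (Nat.prime_of_mem_primeFactors hp).two_le
    set k := n.factorization p
    rw [← Real.rpow_natCast_mul (by positivity), mul_comm (k : ℝ)]
    push_cast
    split_ifs with h
    · refine (hBk k).trans ?_
      gcongr
    · have h2 : (2 : ℝ) ≤ (p : ℝ) ^ ε := by
        have : (2 : ℝ) ^ (1 / ε) ≤ p := hM.trans (by exact_mod_cast not_lt.1 h)
        calc (2 : ℝ) = ((2 : ℝ) ^ (1 / ε)) ^ ε := by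
              rw [← Real.rpow_mul two_pos.le, one_div_mul_cancel hε.ne', Real.rpow_one]
          _ ≤ _ := by gcongr
      rw [one_mul, Real.rpow_mul_natCast (by positivity)]
      calc (k : ℝ) + 1 ≤ 2 ^ k := by exact_mod_cast k.lt_two_pow_self
        _ ≤ _ := by gcongr
  have hconst : ∏ p ∈ n.primeFactors, (if p < M then B else 1) ≤ B ^ M := by
    rw [Finset.prod_ite, Finset.prod_const_one, mul_one, Finset.prod_const]
    refine pow_le_pow_right₀ hB ?_
    calc _ ≤ (Finset.range M).card := Finset.card_le_card fun p hp => by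
            simpa using (Finset.mem_filter.1 hp).2
      _ = M := Finset.card_range M
  have hn' : ∏ p ∈ n.primeFactors, ((p : ℝ) ^ (n.factorization p)) ^ ε = (n : ℝ) ^ ε := by
    rw [Real.finsetProd_rpow _ _ fun _ _ => by positivity]
    congr 1
    exact_mod_cast Nat.prod_factorization_pow_eq_self hn
  rw [Nat.card_divisors hn, Nat.cast_prod]
  calc _ ≤ _ := Finset.prod_le_prod (fun _ _ => by positivity) hlocal
    _ = (∏ p ∈ n.primeFactors, (if p < M then B else 1)) * (n : ℝ) ^ ε := by
      rw [Finset.prod_mul_distrib, hn']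
    _ ≤ _ := by gcongr

/-- The circumradius formula `4 R² D² = |u|² |v|² |u - v|²` for a triangle inscribed in a circle
centred at the origin, where `D` is twice its area. -/
theorem four_mul_sq_mul_cross_sq {A x₁ y₁ x₂ y₂ x₃ y₃ : ℝ} (h₁ : x₁ ^ 2 + y₁ ^ 2 = A)
    (h₂ : x₂ ^ 2 + y₂ ^ 2 = A) (h₃ : x₃ ^ 2 + y₃ ^ 2 = A) :
    4 * A * ((x₂ - x₁) * (y₃ - y₁) - (x₃ - x₁) * (y₂ - y₁)) ^ 2 =
      ((x₂ - x₁) ^ 2 + (y₂ - y₁) ^ 2) * ((x₃ - x₁) ^ 2 + (y₃ - y₁) ^ 2) *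
        ((x₂ - x₃) ^ 2 + (y₂ - y₃) ^ 2) := by
  obtain ⟨a, rfl⟩ : ∃ a, x₂ = x₁ + a := ⟨x₂ - x₁, by ring⟩
  obtain ⟨b, rfl⟩ : ∃ b, y₂ = y₁ + b := ⟨y₂ - y₁, by ring⟩
  obtain ⟨c, rfl⟩ : ∃ c, x₃ = x₁ + c := ⟨x₃ - x₁, by ring⟩
  obtain ⟨d, rfl⟩ : ∃ d, y₃ = y₁ + d := ⟨y₃ - y₁, by ring⟩
  have hu : a ^ 2 + b ^ 2 = -2 * (x₁ * a + y₁ * b) := by linarith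
  have hv : c ^ 2 + d ^ 2 = -2 * (x₁ * c + y₁ * d) := by linarith
  have key : (a ^ 2 + b ^ 2) * (c ^ 2 + d ^ 2) * ((a - c) ^ 2 + (b - d) ^ 2) =
      ((a ^ 2 + b ^ 2) * c - (c ^ 2 + d ^ 2) * a) ^ 2 +
        ((a ^ 2 + b ^ 2) * d - (c ^ 2 + d ^ 2) * b) ^ 2 := by ring
  have hab : ∀ s t : ℝ, (x₁ + s - (x₁ + t)) = s - t := fun s t => by ring
  have hcd : ∀ s t : ℝ, (y₁ + s - (y₁ + t)) = s - t := fun s t => by ring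
  simp only [add_sub_cancel_left, hab, hcd]
  rw [key, hu, hv, ← h₁]
  ring

/-- Three distinct lattice points of a square of side `N` lie on no circle of radius more than
`√2 N³` centred at the origin. -/
theorem le_two_mul_pow_six_of_three_points {N b₁ b₂ A : ℝ} {q : Fin 3 → ℤ × ℤ}
    (hq : Function.Injective q)
    (hmem : ∀ i, b₁ ≤ ((q i).1 : ℝ) ∧ ((q i).1 : ℝ) ≤ b₁ + N ∧
      b₂ ≤ ((q i).2 : ℝ) ∧ ((q i).2 : ℝ) ≤ b₂ + N ∧
      ((q i).1 : ℝ) ^ 2 + ((q i).2 : ℝ) ^ 2 = A) : A ≤ 2 * N ^ 6 := by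
  have hdist : ∀ i j, (((q i).1 : ℝ) - (q j).1) ^ 2 + (((q i).2 : ℝ) - (q j).2) ^ 2 ≤
      2 * N ^ 2 := by
    intro i j
    obtain ⟨h1, h2, h3, h4, -⟩ := hmem i
    obtain ⟨h5, h6, h7, h8, -⟩ := hmem j
    have hx : (((q i).1 : ℝ) - (q j).1) ^ 2 ≤ N ^ 2 :=
      sq_le_sq' (by linarith) (by linarith)
    have hy : (((q i).2 : ℝ) - (q j).2) ^ 2 ≤ N ^ 2 :=
      sq_le_sq' (by linarith) (by linarith)
    linarith
  have hpos : ∀ i j, i ≠ j →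
      0 < (((q i).1 : ℝ) - (q j).1) ^ 2 + (((q i).2 : ℝ) - (q j).2) ^ 2 := by
    intro i j hij
    by_contra! hle
    have hx : ((q i).1 : ℝ) - (q j).1 = 0 := by
      nlinarith [sq_nonneg (((q i).1 : ℝ) - (q j).1), sq_nonneg (((q i).2 : ℝ) - (q j).2)]
    have hy : ((q i).2 : ℝ) - (q j).2 = 0 := by
      nlinarith [sq_nonneg (((q i).1 : ℝ) - (q j).1), sq_nonneg (((q i).2 : ℝ) - (q j).2)]
    exact hij (hq (Prod.ext (by exact_mod_cast sub_eq_zero.1 hx)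
      (by exact_mod_cast sub_eq_zero.1 hy)))
  have hA : 0 ≤ A := by rw [← (hmem 0).2.2.2.2]; positivity
  have hR := four_mul_sq_mul_cross_sq (hmem 0).2.2.2.2 (hmem 1).2.2.2.2 (hmem 2).2.2.2.2
  set D : ℤ := ((q 1).1 - (q 0).1) * ((q 2).2 - (q 0).2) -
    ((q 2).1 - (q 0).1) * ((q 1).2 - (q 0).2) with hD
  have hDR : (((q 1).1 : ℝ) - (q 0).1) * ((q 2).2 - (q 0).2) -
    ((q 2).1 - (q 0).1) * ((q 1).2 - (q 0).2) = D := by rw [hD]; push_cast; ring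
  rw [hDR] at hR
  have hprod := mul_pos (mul_pos (hpos 1 0 (by decide)) (hpos 2 0 (by decide)))
    (hpos 1 2 (by decide))
  have hD0 : D ≠ 0 := by
    intro h0
    rw [← hR, h0] at hprod
    simp at hprod
  have hD1 : (1 : ℝ) ≤ (D : ℝ) ^ 2 := by
    exact_mod_cast Int.add_one_le_of_lt (sq_pos_of_ne_zero hD0)
  have hle : 4 * A * (D : ℝ) ^ 2 ≤ 2 * N ^ 2 * (2 * N ^ 2) * (2 * N ^ 2) := by
    rw [hR]
    gcongr
    exacts [hdist 1 0, hdist 2 0, hdist 1 2]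
  nlinarith

theorem lattice_points_on_circle_in_square (ε : ℝ) (hε : 0 < ε) :
    ∃ C : ℝ, 0 < C ∧ ∀ (N : ℝ), 1 ≤ N → ∀ (b₁ b₂ A : ℝ),
      (({q : ℤ × ℤ | b₁ ≤ (q.1 : ℝ) ∧ (q.1 : ℝ) ≤ b₁ + N ∧
          b₂ ≤ (q.2 : ℝ) ∧ (q.2 : ℝ) ≤ b₂ + N ∧
          (q.1 : ℝ) ^ 2 + (q.2 : ℝ) ^ 2 = A}).ncard : ℝ) ≤ C * N ^ ε := by
  obtain ⟨C, hC, hdiv⟩ := exists_card_divisors_le_mul_rpow (ε / 12) (by positivity)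
  refine ⟨9 * (C * 2 ^ (ε / 12)) ^ 2, by positivity, fun N hN b₁ b₂ A => ?_⟩
  set T := {q : ℤ × ℤ | b₁ ≤ (q.1 : ℝ) ∧ (q.1 : ℝ) ≤ b₁ + N ∧
          b₂ ≤ (q.2 : ℝ) ∧ (q.2 : ℝ) ≤ b₂ + N ∧
          (q.1 : ℝ) ^ 2 + (q.2 : ℝ) ^ 2 = A} with hT
  have hN0 : 0 ≤ N := by linarith
  have hC2 : 1 ≤ C * 2 ^ (ε / 12) :=
    one_le_mul_of_one_le_of_one_le hC (Real.one_le_rpow one_le_two (by positivity))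
  by_cases hcard : T.ncard ≤ 2
  · have h1 : (T.ncard : ℝ) ≤ 2 := by exact_mod_cast hcard
    have h2 : 1 ≤ (C * 2 ^ (ε / 12)) ^ 2 := one_le_pow₀ hC2
    have h3 : 1 ≤ N ^ ε := Real.one_le_rpow hN hε.le
    nlinarith
  obtain ⟨p, q, r, hp, hq, hr, hpq, hpr, hqr⟩ :=
    (Set.two_lt_ncard_iff (Set.finite_of_ncard_pos (by omega))).1 (not_le.1 hcard)
  have hA : A ≤ 2 * N ^ 6 := by
    refine le_two_mul_pow_six_of_three_points (q := ![p, q, r]) (b₁ := b₁) (b₂ := b₂) ?_ ?_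
    · intro i j hij
      fin_cases i <;> fin_cases j <;> simp_all
    · intro i
      fin_cases i
      exacts [hp, hq, hr]
  obtain ⟨n, hn⟩ : ∃ n : ℕ, (n : ℤ) = p.1 ^ 2 + p.2 ^ 2 :=
    ⟨(p.1 ^ 2 + p.2 ^ 2).toNat, Int.toNat_of_nonneg (by positivity)⟩
  have hnA : (n : ℝ) = A := by
    rw [← hp.2.2.2.2]
    exact_mod_cast hn
  have hsub : T ⊆ {q : ℤ × ℤ | q.1 ^ 2 + q.2 ^ 2 = n} := by
    intro q hq
    have := hq.2.2.2.2
    rw [← hnA] at this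
    exact_mod_cast this
  have hn0 : n ≠ 0 := by
    rintro rfl
    have hzero : ∀ z ∈ T, z = 0 := by
      intro z hz
      have h : z.1 ^ 2 + z.2 ^ 2 = 0 := by simpa using hsub hz
      exact Prod.ext (by simp only [Prod.fst_zero]; nlinarith [sq_nonneg z.1, sq_nonneg z.2])
        (by simp only [Prod.snd_zero]; nlinarith [sq_nonneg z.1, sq_nonneg z.2])
    exact hpq ((hzero p hp).trans (hzero q hq).symm)
  obtain ⟨hfin, hle⟩ := ncard_sq_add_sq_le n hn0
  calc (T.ncard : ℝ) ≤ 9 * (n.divisors.card : ℝ) ^ 2 := by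
        exact_mod_cast (Set.ncard_le_ncard hsub hfin).trans hle
    _ ≤ 9 * (C * (2 * N ^ 6) ^ (ε / 12)) ^ 2 := by
        gcongr
        refine (hdiv n hn0).trans ?_
        gcongr
        rwa [hnA]
    _ = 9 * (C * 2 ^ (ε / 12)) ^ 2 * N ^ ε := by
        rw [Real.mul_rpow two_pos.le (by positivity), ← mul_assoc C, mul_pow, ← mul_assoc 9]
        congr 1
        rw [← Real.rpow_natCast_mul hN0, ← Real.rpow_mul_natCast hN0]
        congr 1
        push_cast
        ring
end
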